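/- arXiv:1711.10365 — 14 statements merged into one kernel-verified Lean document; each statement's English description precedes it below -/
import Mathlib

section
/- Let A be an integral domain of characteristic 0 whose group of units A* is finite. Then A* is cyclic of order 2, 4, or 6. -/
/-- Two complex numbers of norm one that are equally far from `1` are equal or inverse. -/
theorem Complex.eq_or_mul_eq_one_of_norm_sub_one_eq {z w : ℂ} (hz : ‖z‖ = 1) (hw : ‖w‖ = 1)
    (h : ‖z - 1‖ = ‖w - 1‖) : z = w ∨ z * w = 1 := by
  have hz' : z.re * z.re + z.im * z.im = 1 := by
    rw [← Complex.normSq_apply, Complex.normSq_eq_norm_sq, hz, one_pow]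
  have hw' : w.re * w.re + w.im * w.im = 1 := by
    rw [← Complex.normSq_apply, Complex.normSq_eq_norm_sq, hw, one_pow]
  have h' : Complex.normSq (z - 1) = Complex.normSq (w - 1) := by
    rw [Complex.normSq_eq_norm_sq, Complex.normSq_eq_norm_sq, h]
  simp only [Complex.normSq_apply, Complex.sub_re, Complex.sub_im, Complex.one_re,
    Complex.one_im, sub_zero] at h'
  have hre : z.re = w.re := by linarith
  have him : (z.im - w.im) * (z.im + w.im) = 0 := by rw [hre] at hz'; linarith
  rcases mul_eq_zero.mp him with him | him
  · exact Or.inl (Complex.ext hre (sub_eq_zero.mp him))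
  · have him' : z.im = -w.im := by linarith
    right
    apply Complex.ext
    · rw [Complex.mul_re, hre, him', Complex.one_re]; linarith
    · rw [Complex.mul_im, hre, him', Complex.one_im]; ring

/-- An integral polynomial vanishing at a primitive `n`-th root of unity of a field of characteristic
zero is divisible by the `n`-th cyclotomic polynomial. -/
theorem Polynomial.cyclotomic_dvd_of_eval₂_eq_zero {K : Type*} [Field K] [CharZero K] {n : ℕ}
    (hn : 0 < n) {ζ : K} (hζ : IsPrimitiveRoot ζ n) {p : Polynomial ℤ}
    (hp : p.eval₂ (Int.castRingHom K) ζ = 0) : Polynomial.cyclotomic n ℤ ∣ p := by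
  rw [Polynomial.cyclotomic_eq_minpoly hζ hn]
  exact minpoly.isIntegrallyClosed_dvd (hζ.isIntegral hn) hp

/-- An integral polynomial relation satisfied by one primitive `n`-th root of unity in a domain of
characteristic zero is satisfied by every primitive `n`-th root of unity. -/
theorem IsPrimitiveRoot.eval₂_eq_zero_of_eval₂_eq_zero {A B : Type*} [CommRing A] [IsDomain A]
    [CharZero A] [CommRing B] [IsDomain B] {n : ℕ} (hn : 0 < n) {ζ : A} {ξ : B}
    (hζ : IsPrimitiveRoot ζ n) (hξ : IsPrimitiveRoot ξ n) {p : Polynomial ℤ}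
    (hp : p.eval₂ (Int.castRingHom A) ζ = 0) : p.eval₂ (Int.castRingHom B) ξ = 0 := by
  have hinj := IsFractionRing.injective A (FractionRing A)
  have : CharZero (FractionRing A) := charZero_of_injective_algebraMap hinj
  obtain ⟨q, rfl⟩ := Polynomial.cyclotomic_dvd_of_eval₂_eq_zero hn
    (hζ.map_of_injective hinj) (p := p) (by
      rw [← RingHom.eq_intCast' ((algebraMap A (FractionRing A)).comp (Int.castRingHom A)),
        ← Polynomial.hom_eval₂, hp, map_zero])
  rw [Polynomial.eval₂_mul, Polynomial.eval₂_eq_eval_map, Polynomial.map_cyclotomic,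
    (hξ.isRoot_cyclotomic hn).eq_zero, zero_mul]

/-- In a domain of characteristic zero, a cyclotomic unit `(ζ ^ k - 1) / (ζ - 1)` is a power of `ζ`
only if `k ≡ ±1` modulo the order of `ζ`. -/
theorem IsPrimitiveRoot.geom_sum_ne_pow {A : Type*} [CommRing A] [IsDomain A] [CharZero A]
    {n k : ℕ} {ζ : A} (hζ : IsPrimitiveRoot ζ n) (hk : 1 < k) (hkn : k + 1 < n) (j : ℕ) :
    ∑ i ∈ Finset.range k, ζ ^ i ≠ ζ ^ j := by
  intro h
  have hn : n ≠ 0 := by omega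
  have hξ := Complex.isPrimitiveRoot_exp n hn
  set ξ := Complex.exp (2 * Real.pi * Complex.I / n)
  have hrel : ∑ i ∈ Finset.range k, ξ ^ i = ξ ^ j := by
    have := hζ.eval₂_eq_zero_of_eval₂_eq_zero (Nat.pos_of_ne_zero hn) hξ
      (p := ∑ i ∈ Finset.range k, Polynomial.X ^ i - Polynomial.X ^ j)
      (by simp [Polynomial.eval₂_finsetSum, h])
    simpa [Polynomial.eval₂_finsetSum, sub_eq_zero] using this
  have hnorm : ‖ξ‖ = 1 := hξ.norm'_eq_one hn
  have hdist : ‖ξ ^ k - 1‖ = ‖ξ - 1‖ := by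
    rw [← geom_sum_mul, hrel, norm_mul, norm_pow, hnorm, one_pow, one_mul]
  rcases Complex.eq_or_mul_eq_one_of_norm_sub_one_eq (by rw [norm_pow, hnorm, one_pow]) hnorm hdist
    with h1 | h1
  · exact hk.ne' (hξ.pow_inj (by omega) (by omega) (h1.trans (pow_one ξ).symm))
  · rw [← pow_succ] at h1
    exact hξ.pow_ne_one_of_pos_of_lt (by omega) hkn h1

theorem Nat.exists_coprime_of_even {n : ℕ} (hn : Even n) (h6 : 6 < n) :
    ∃ k, 1 < k ∧ k + 1 < n ∧ k.Coprime n := by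
  obtain ⟨m, rfl⟩ := hn
  obtain ⟨r, rfl | rfl⟩ := m.even_or_odd'
  · refine ⟨2 * r - 1, by omega, by omega, ?_⟩
    obtain ⟨s, rfl⟩ : ∃ s, r = s + 1 := ⟨r - 1, by omega⟩
    have h1 : 2 * (s + 1) - 1 = 2 * s + 1 := by omega
    have h2 : 2 * (s + 1) + 2 * (s + 1) = 2 + 2 * (2 * s + 1) := by ring
    rw [h1, h2, Nat.coprime_add_mul_right_right]
    simp
  · refine ⟨2 * r - 1, by omega, by omega, ?_⟩
    obtain ⟨s, rfl⟩ : ∃ s, r = s + 1 := ⟨r - 1, by omega⟩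
    have h1 : 2 * (s + 1) - 1 = 2 * s + 1 := by omega
    have h2 : 2 * (s + 1) + 1 + (2 * (s + 1) + 1) = 2 ^ 2 + 2 * (2 * s + 1) := by ring
    rw [h1, h2, Nat.coprime_add_mul_right_right]
    exact Nat.Coprime.pow_right 2 (by simp)

/-- Let `A` be an integral domain of characteristic 0 whose group of units is finite.
Then `Aˣ` is cyclic of order 2, 4, or 6. -/
theorem stmt_1 (A : Type*) [CommRing A] [IsDomain A] [CharZero A] [Finite Aˣ] :
    IsCyclic Aˣ ∧ (Nat.card Aˣ = 2 ∨ Nat.card Aˣ = 4 ∨ Nat.card Aˣ = 6) := by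
  have hcyc : IsCyclic Aˣ := inferInstance
  refine ⟨hcyc, ?_⟩
  obtain ⟨u, hu⟩ := IsCyclic.exists_generator (α := Aˣ)
  have hζ : IsPrimitiveRoot (u : A) (Nat.card Aˣ) := by
    rw [IsPrimitiveRoot.coe_units_iff, ← orderOf_eq_card_of_forall_mem_zpowers hu]
    exact IsPrimitiveRoot.orderOf u
  have hpos : 0 < Nat.card Aˣ := Nat.card_pos
  have heven : Even (Nat.card Aˣ) := by
    have h2 : orderOf (-1 : Aˣ) = 2 := by
      rw [← orderOf_units, Units.val_neg, Units.val_one, orderOf_neg_one,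
        ringChar.eq_zero, if_neg (by norm_num)]
    exact even_iff_two_dvd.mpr (h2 ▸ orderOf_dvd_natCard (-1 : Aˣ))
  have hle : Nat.card Aˣ ≤ 6 := by
    by_contra! h6
    obtain ⟨k, hk, hkn, hcop⟩ := Nat.exists_coprime_of_even heven h6
    obtain ⟨v, hv⟩ := hζ.geom_sum_isUnit (by omega) hcop
    obtain ⟨j, hj⟩ := mem_powers_iff_mem_zpowers.mpr (hu v)
    apply hζ.geom_sum_ne_pow hk hkn j
    rw [← hv, ← hj, Units.val_pow_eq_pow_val]
  obtain ⟨m, hm⟩ := heven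
  omega
end

section
/- Let A be a commutative ring with identity whose group of units A* is finite. Then every nilpotent element of A has finite additive order. In particular, if the additive group of A is torsion-free, then A is reduced (has no nonzero nilpotent elements). -/
/-- In a commutative ring with finitely many units, every nilpotent element has finite additive
order: two of the units `1 + n • x` must coincide. -/
theorem IsNilpotent.exists_pos_nsmul_eq_zero {A : Type*} [CommRing A] [Finite Aˣ] {x : A}
    (hx : IsNilpotent x) : ∃ n : ℕ, 0 < n ∧ n • x = 0 := by
  have hu (n : ℕ) : IsUnit (1 + n • x) := (hx.smul n).isUnit_one_add
  obtain ⟨m, n, hmn, h⟩ := Finite.exists_ne_map_eq_of_infinite fun n : ℕ => (hu n).unit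
  have h' : m • x = n • x := by simpa using congrArg Units.val h
  wlog hlt : m < n generalizing m n
  · exact this n m hmn.symm h.symm h'.symm (by omega)
  · exact ⟨n - m, Nat.sub_pos_of_lt hlt, by rw [sub_nsmul x hlt.le, h', add_neg_cancel]⟩

/-- Let `A` be a commutative ring whose group of units is finite. Then every nilpotent
element of `A` has finite additive order; in particular if `A` is (additively)
torsion-free then `A` is reduced. -/
theorem stmt_2 (A : Type*) [CommRing A] [Finite Aˣ] :
    (∀ x : A, IsNilpotent x → ∃ n : ℕ, 0 < n ∧ n • x = 0) ∧
      ((∀ (n : ℕ) (a : A), 0 < n → n • a = 0 → a = 0) → IsReduced A) := by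
  refine ⟨fun x hx => hx.exists_pos_nsmul_eq_zero, fun h => ⟨fun x hx => ?_⟩⟩
  obtain ⟨n, hn, hnx⟩ := hx.exists_pos_nsmul_eq_zero
  exact h n x hn hnx
end

section
/- Let A be a commutative ring with identity whose additive group is torsion-free and whose group of units A* is finite. Let p be a prime and k ≥ 1 an integer with p^k ∉ {2, 3, 4}. Then A* contains no element of multiplicative order p^k. -/
open Polynomial in
/-- If `α ^ p ^ (j + 1) = 1` in a torsion-free ring and `α` is a root of an integer polynomial that
does not vanish at a primitive `p ^ (j + 1)`-th root of unity, then already `α ^ p ^ j = 1`. -/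
theorem pow_prime_pow_eq_one_of_aeval_eq_zero {A : Type*} [CommRing A]
    (htf : ∀ (n : ℕ) (a : A), 0 < n → n • a = 0 → a = 0) {p j : ℕ} (hp : p.Prime) {α : A}
    (hα : α ^ p ^ (j + 1) = 1) {f : ℤ[X]} (hf : aeval α f = 0) {ζ : ℂ}
    (hζ : IsPrimitiveRoot ζ (p ^ (j + 1))) (hfζ : aeval ζ f ≠ 0) : α ^ p ^ j = 1 := by
  have : Fact p.Prime := ⟨hp⟩
  have hn : 0 < p ^ (j + 1) := pow_pos hp.pos _
  have hcop : IsCoprime (cyclotomic (p ^ (j + 1)) ℚ) (f.map (algebraMap ℤ ℚ)) := by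
    refine ((cyclotomic.irreducible_rat hn).coprime_iff_not_dvd).2 fun ⟨g, hg⟩ ↦ hfζ ?_
    rw [← aeval_map_algebraMap ℚ, hg, map_mul, cyclotomic_eq_minpoly_rat hζ hn, minpoly.aeval,
      zero_mul]
  obtain ⟨a, b, hab⟩ := hcop
  obtain ⟨c, hc, hca⟩ := IsLocalization.integerNormalization_spec (nonZeroDivisors ℤ) a
  obtain ⟨d, hd, hdb⟩ := IsLocalization.integerNormalization_spec (nonZeroDivisors ℤ) b
  set a' := IsLocalization.integerNormalization (nonZeroDivisors ℤ) a
  set b' := IsLocalization.integerNormalization (nonZeroDivisors ℤ) b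
  rw [zsmul_eq_mul] at hca hdb
  have key : (d : ℤ[X]) * a' * (X ^ p ^ (j + 1) - 1) + (c : ℤ[X]) * b' * f * (X ^ p ^ j - 1)
      = ((c * d : ℤ) : ℤ[X]) * (X ^ p ^ j - 1) := by
    apply map_injective (algebraMap ℤ ℚ) (algebraMap ℤ ℚ).injective_int
    have h := cyclotomic_prime_pow_mul_X_pow_sub_one ℚ p j
    simp only [Polynomial.map_add, Polynomial.map_mul, Polynomial.map_sub, Polynomial.map_pow,
      map_X, Polynomial.map_one, Polynomial.map_intCast, hca, hdb, ← h, Int.cast_mul]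
    linear_combination ((c : ℚ[X]) * d * (X ^ p ^ j - 1)) * hab
  have hzero := congrArg (aeval α) key
  simp only [map_add, map_mul, map_sub, map_pow, aeval_X, map_one, hα, hf, map_intCast, sub_self,
    mul_zero, zero_mul, add_zero] at hzero
  have hcd : c * d ≠ 0 := mul_ne_zero (nonZeroDivisors.ne_zero hc) (nonZeroDivisors.ne_zero hd)
  rw [← sub_eq_zero]
  refine htf (c * d).natAbs _ (Int.natAbs_pos.2 hcd) ?_
  rw [← natCast_zsmul, zsmul_eq_mul]
  rcases Int.natAbs_eq (c * d) with h | h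
  · rw [← h]
    simpa using hzero.symm
  · rw [← neg_eq_iff_eq_neg.2 h]
    simpa using hzero.symm

theorem sum_range_mul_pow {A : Type*} [CommSemiring A] (x : A) (m r : ℕ) :
    ∑ i ∈ Finset.range (m * r), x ^ i
      = (∑ i ∈ Finset.range m, x ^ i) * ∑ i ∈ Finset.range r, (x ^ m) ^ i := by
  induction r with
  | zero => simp
  | succ r ih =>
    rw [Nat.mul_succ, Finset.sum_range_add, ih, Finset.sum_range_succ _ r, mul_add]
    simp only [pow_add, pow_mul, ← Finset.mul_sum]
    ring

/-- The Bass cyclic unit attached to an element `α` with `α ^ n = 1`, in a torsion-free ring. -/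
theorem isUnit_bass {A : Type*} [CommRing A]
    (htf : ∀ (n : ℕ) (a : A), 0 < n → n • a = 0 → a = 0) {n m e q : ℕ} (hn : 0 < n)
    {α : A} (hα : α ^ n = 1) (hq : m ^ (e + 1) = n * q + 1) :
    IsUnit ((∑ i ∈ Finset.range m, α ^ i) ^ (e + 1) - q * ∑ i ∈ Finset.range n, α ^ i) := by
  set σ := ∑ i ∈ Finset.range n, α ^ i with hσ
  have hασ : α * σ = σ := by
    have := mul_geom_sum α n
    rw [hα] at this
    linear_combination this
  have hpow (i : ℕ) : α ^ i * σ = σ := by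
    induction i with
    | zero => simp
    | succ i ih => rw [pow_succ, mul_assoc, hασ, ih]
  have hsum (l r : ℕ) : (∑ i ∈ Finset.range l, (α ^ r) ^ i) * σ = l * σ := by
    simp [Finset.sum_mul, ← pow_mul, hpow]
  have hpowsum {x : A} {l : ℕ} (h : x * σ = l * σ) (i : ℕ) : x ^ i * σ = (l : A) ^ i * σ := by
    induction i with
    | zero => simp
    | succ i ih => linear_combination x ^ i * h + (l : A) * ih
  have hσσ : σ * σ = n * σ := by simpa using hsum n 1
  have hs : (∑ i ∈ Finset.range m, α ^ i) * σ = m * σ := by simpa using hsum m 1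
  have ht := hsum (m ^ e) m
  have hst : (∑ i ∈ Finset.range m, α ^ i) * ∑ i ∈ Finset.range (m ^ e), (α ^ m) ^ i
      = 1 + q * σ := by
    rw [← sum_range_mul_pow, ← pow_succ', hq, Finset.sum_range_succ, sum_range_mul_pow, pow_mul, hα]
    simp [← hσ]
    ring
  set s := ∑ i ∈ Finset.range m, α ^ i
  set t := ∑ i ∈ Finset.range (m ^ e), (α ^ m) ^ i
  have hqA : (n : A) * q = (m : A) ^ (e + 1) - 1 := by
    rw [eq_sub_iff_add_eq]
    exact_mod_cast congrArg (Nat.cast : ℕ → A) hq.symm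
  obtain ⟨b, hb⟩ : ∃ b : A, n * b = 1 - ((m : A) ^ e) ^ (e + 1) := by
    obtain ⟨b, hb⟩ := sub_dvd_pow_sub_pow ((m : A) ^ (e + 1)) 1 e
    refine ⟨-q * b, ?_⟩
    rw [one_pow, ← hqA] at hb
    linear_combination hb
  have hpowst (i : ℕ) : (n : A) * (1 + q * σ) ^ i = n + ((m : A) ^ (e + 1)) ^ i * σ - σ := by
    induction i with
    | zero => simp
    | succ i ih =>
      linear_combination (1 + q * σ) * ih + q * (((m : A) ^ (e + 1)) ^ i - 1) * hσσ
        + ((m : A) ^ (e + 1)) ^ i * σ * hqA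
  refine IsUnit.of_mul_eq_one (t ^ (e + 1) + b * σ) (sub_eq_zero.1 (htf n _ hn ?_))
  rw [nsmul_eq_mul]
  have h1 := hpowsum hs (e + 1)
  have h2 := hpowsum ht (e + 1)
  have h3 := hpowst (e + 1)
  rw [← hst, mul_pow] at h3
  push_cast at h2
  linear_combination h3 + n * b * h1 - n * q * h2 - n * q * b * hσσ
    + ((m : A) ^ (e + 1) * σ) * hb - ((m : A) ^ e) ^ (e + 1) * σ * hqA
    - b * n * σ * hqA - ((m : A) ^ (e + 1) - 1) * σ * hb

theorem one_lt_re_exp_sum {n m : ℕ} (hn : 5 ≤ n) (h : m = 2 ∨ m = 3 ∧ 8 ≤ n) :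
    1 < (∑ i ∈ Finset.range m, Complex.exp (2 * Real.pi * Complex.I / n) ^ i).re := by
  have hre (i : ℕ) :
      (Complex.exp (2 * Real.pi * Complex.I / n) ^ i).re = Real.cos (i * (2 * Real.pi / n)) := by
    rw [← Complex.exp_nat_mul, ← Complex.exp_ofReal_mul_I_re]
    congr 2
    push_cast
    ring
  have hpi := Real.pi_pos
  have hn' : (5 : ℝ) ≤ n := by exact_mod_cast hn
  have h0 : 0 < 2 * Real.pi / n := by positivity
  have h1 : 0 < Real.cos (2 * Real.pi / n) := by
    apply Real.cos_pos_of_mem_Ioo ⟨by linarith, _⟩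
    rw [div_lt_div_iff₀ (by linarith) two_pos]
    nlinarith
  rcases h with rfl | ⟨rfl, h8⟩
  · simpa only [Finset.sum_range_succ, Finset.sum_range_zero, Complex.add_re, hre, Nat.cast_zero,
      Nat.cast_one, zero_mul, one_mul, Real.cos_zero, Complex.zero_re, zero_add,
      lt_add_iff_pos_right] using h1
  · have h8' : (8 : ℝ) ≤ n := by exact_mod_cast h8
    have h2 : 0 ≤ Real.cos (2 * (2 * Real.pi / n)) := by
      apply Real.cos_nonneg_of_mem_Icc ⟨by linarith, _⟩
      rw [← mul_div_assoc, div_le_div_iff₀ (by linarith) two_pos]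
      nlinarith
    simp only [Finset.sum_range_succ, Finset.sum_range_zero, Complex.add_re, hre]
    simp
    linarith

open Polynomial in
/-- Let `A` be a commutative ring, additively torsion-free, with finite unit group.
Let `p` be a prime and `k ≥ 1` with `p ^ k ∉ {2, 3, 4}`. Then `Aˣ` has no element of
order `p ^ k`. -/
theorem stmt_5 (A : Type*) [CommRing A] [Finite Aˣ]
    (htf : ∀ (n : ℕ) (a : A), 0 < n → n • a = 0 → a = 0)
    (p k : ℕ) (hp : p.Prime) (hk : 1 ≤ k)
    (h2 : p ^ k ≠ 2) (h3 : p ^ k ≠ 3) (h4 : p ^ k ≠ 4) :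
    ∀ α : Aˣ, orderOf α ≠ p ^ k := by
  intro α hα
  obtain ⟨j, rfl⟩ : ∃ j, k = j + 1 := ⟨k - 1, by lia⟩
  have hn1 : 1 < p ^ (j + 1) := Nat.one_lt_pow (by lia) hp.one_lt
  obtain ⟨m, hm, hcop⟩ : ∃ m : ℕ, (m = 2 ∨ m = 3 ∧ 8 ≤ p ^ (j + 1)) ∧
      m.Coprime (p ^ (j + 1)) := by
    rcases hp.eq_two_or_odd' with rfl | hodd
    · refine ⟨3, .inr ⟨rfl, ?_⟩, Nat.Coprime.pow_right _ (by norm_num)⟩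
      have hj : 3 ≤ j + 1 := by
        by_contra! hj
        obtain rfl | rfl : j = 0 ∨ j = 1 := by lia
        · exact h2 rfl
        · exact h4 rfl
      simpa using Nat.pow_le_pow_right two_pos hj
    · exact ⟨2, .inl rfl, Nat.coprime_two_left.2 hodd.pow⟩
  have hre := one_lt_re_exp_sum (n := p ^ (j + 1)) (by lia) hm
  have hζ := Complex.isPrimitiveRoot_exp (p ^ (j + 1)) (by lia)
  have hαn : (α : A) ^ p ^ (j + 1) = 1 := by
    rw [← hα, ← Units.val_pow_eq_pow_val, pow_orderOf_eq_one, Units.val_one]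
  obtain ⟨e, he⟩ : ∃ e, Nat.totient (p ^ (j + 1)) = e + 1 :=
    Nat.exists_eq_add_one.2 (Nat.totient_pos.2 (by lia))
  obtain ⟨q, hq⟩ := (Nat.modEq_iff_dvd' (Nat.one_le_pow _ m (by lia))).1
    (Nat.ModEq.pow_totient hcop).symm
  rw [he] at hq
  push_cast at hζ hre
  set ζ := Complex.exp (2 * Real.pi * Complex.I / p ^ (j + 1))
  obtain ⟨u, hu⟩ := isUnit_bass htf (m := m) (e := e) (q := q) (by lia) hαn
    (by have := Nat.one_le_pow (e + 1) m (by lia); lia)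
  have hζ0 := hζ.geom_sum_eq_zero hn1
  have hone := pow_prime_pow_eq_one_of_aeval_eq_zero htf hp hαn
    (f := ((∑ i ∈ Finset.range m, X ^ i) ^ (e + 1)
      - C (q : ℤ) * ∑ i ∈ Finset.range (p ^ (j + 1)), X ^ i) ^ Nat.card Aˣ - 1) (ζ := ζ)
    (by
      simp only [map_sub, map_pow, map_mul, map_sum, aeval_X, aeval_C, map_one]
      rw [eq_intCast, Int.cast_natCast, ← hu, ← Units.val_pow_eq_pow_val, pow_card_eq_one',
        Units.val_one, sub_self])
    hζ
    (by
      simp only [map_sub, map_pow, map_mul, map_sum, aeval_X, aeval_C, map_one, hζ0,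
        mul_zero, sub_zero, ← pow_mul]
      intro h
      have := Complex.norm_eq_one_of_pow_eq_one (sub_eq_zero.1 h)
        (mul_ne_zero (by lia) Nat.card_pos.ne')
      exact (hre.trans_le (Complex.re_le_norm _)).ne' this)
  have hdvd : p ^ (j + 1) ∣ p ^ j :=
    hα ▸ orderOf_dvd_of_pow_eq_one (Units.ext (by simpa using hone))
  exact absurd (Nat.le_of_dvd (pow_pos hp.pos _) hdvd)
    (not_le.2 (Nat.pow_lt_pow_right hp.one_lt (by lia)))
end

section
/- Let A be a commutative ring with identity whose additive group is torsion-free and whose group of units A* is finite. Then A* contains no element α of multiplicative order 12 satisfying α^6 = −1. -/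
/-- If `t ^ 3 = 3 * t`, multiplying `t` by powers of `t ^ 2 + t - 1` is governed by the solutions
of the Pell equation `a ^ 2 = 3 * b ^ 2 + 1`. -/
theorem exists_pell_mul_pow_eq {A : Type*} [CommRing A] {t : A} (ht : t ^ 3 = 3 * t) (n : ℕ) :
    ∃ a b : ℕ, n + 1 ≤ a ∧ a ^ 2 = 3 * b ^ 2 + 1 ∧
      t * (t ^ 2 + t - 1) ^ n = a * t + b * t ^ 2 := by
  induction n with
  | zero => exact ⟨1, 0, by simp⟩
  | succ n ih =>
    obtain ⟨a, b, hle, hpell, h⟩ := ih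
    refine ⟨2 * a + 3 * b, a + 2 * b, by omega, by linarith, ?_⟩
    rw [pow_succ, ← mul_assoc, h]
    push_cast
    linear_combination (a + b + b * t) * ht

/-- In a torsion-free ring with finitely many units, the equation `t ^ 3 = 3 * t` forces
`t = 0`. -/
theorem eq_zero_of_pow_three_eq_three_mul {A : Type*} [CommRing A] [Finite Aˣ]
    (htf : ∀ (n : ℕ) (a : A), 0 < n → n • a = 0 → a = 0) {t : A} (ht : t ^ 3 = 3 * t) :
    t = 0 := by
  have hinv : (t ^ 2 + t - 1) * (t ^ 2 - t - 1) = 1 := by linear_combination t * ht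
  let w : Aˣ := ⟨t ^ 2 + t - 1, t ^ 2 - t - 1, hinv, by rw [mul_comm, hinv]⟩
  obtain ⟨n, hn, hw⟩ := (isOfFinOrder_of_finite w).exists_pow_eq_one
  have hw' : (t ^ 2 + t - 1) ^ n = 1 := by simpa [w] using congrArg Units.val hw
  obtain ⟨a, b, hle, hpell, h⟩ := exists_pell_mul_pow_eq ht n
  rw [hw', mul_one] at h
  have hpellA : (a : A) ^ 2 = 3 * b ^ 2 + 1 := by exact_mod_cast congrArg (Nat.cast : ℕ → A) hpell
  refine htf (2 * (a - 1)) t (by omega) ?_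
  rw [nsmul_eq_mul, Nat.cast_mul, Nat.cast_sub (by omega)]
  push_cast
  linear_combination (a - 1 - b * t) * h + t * hpellA - b ^ 2 * ht

/-- Let `A` be a commutative ring, additively torsion-free, with finite unit group.
Then `Aˣ` contains no element `α` of order 12 with `α ^ 6 = -1`. -/
theorem stmt_6 (A : Type*) [CommRing A] [Finite Aˣ]
    (htf : ∀ (n : ℕ) (a : A), 0 < n → n • a = 0 → a = 0) :
    ¬ ∃ α : Aˣ, orderOf α = 12 ∧ α ^ 6 = -1 := by
  rintro ⟨α, hord, hα⟩
  obtain ⟨x, hx⟩ : ∃ x : A, x = α := ⟨_, rfl⟩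
  obtain ⟨y, hy⟩ : ∃ y : A, y = (α⁻¹ : Aˣ) := ⟨_, rfl⟩
  have hxy : x * y = 1 := by rw [hx, hy, Units.mul_inv]
  have hx6 : x ^ 6 = -1 := by rw [hx]; simpa using congrArg Units.val hα
  have hxy3 : x ^ 3 * y ^ 3 = 1 := by rw [← mul_pow, hxy, one_pow]
  have ht : x + y = 0 := eq_zero_of_pow_three_eq_three_mul htf (by
    linear_combination 3 * (x + y) * hxy + y ^ 3 * hx6 - x ^ 3 * hxy3)
  have hx2 : x ^ 2 = -1 := by linear_combination x * ht - hxy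
  have hα4 : α ^ 4 = 1 := by
    ext
    push_cast
    rw [← hx]
    linear_combination (x ^ 2 - 1) * hx2
  have hdvd := orderOf_dvd_of_pow_eq_one hα4
  rw [hord] at hdvd
  omega
end

section
/- For each n ≥ 0, let A_n be the quotient of the polynomial ring ℤ[x_0, x_1, …, x_n] in n+1 variables by the ideal generated by the polynomials x_i² + x_i + 1 for i = 0, 1, …, n. Then A_n is a reduced ring, its additive group is torsion-free, and its group of units A_n* is isomorphic to ℤ/2ℤ × (ℤ/3ℤ)^{n+1}. -/
/-- The ideal of `ℤ[x_0, …, x_n]` generated by the polynomials `x_i ^ 2 + x_i + 1`. -/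
noncomputable def stmt9Ideal (n : ℕ) : Ideal (MvPolynomial (Fin (n + 1)) ℤ) :=
  Ideal.span (Set.range fun i : Fin (n + 1) =>
    MvPolynomial.X i ^ 2 + MvPolynomial.X i + 1)

/-- The ring of Eisenstein integers `ℤ[ω]`, with `ω ^ 2 = -1 - ω`. -/
abbrev Eisenstein : Type := QuadraticAlgebra ℤ (-1) (-1)

namespace Eisenstein

open QuadraticAlgebra MvPolynomial

/-- The primitive cube root of unity `ω`. -/
abbrev root : Eisenstein := ⟨0, 1⟩

lemma norm_eq (z : Eisenstein) : norm z = z.re ^ 2 - z.re * z.im + z.im ^ 2 := by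
  rw [norm_def]; ring

lemma eq_zero_of_norm_eq_zero {z : Eisenstein} (h : norm z = 0) : z = 0 := by
  rw [norm_eq] at h
  have him : z.im = 0 := by nlinarith [sq_nonneg (2 * z.re - z.im), sq_nonneg z.im]
  have hre : z.re = 0 := by simpa [him] using h
  ext <;> simp [hre, him]

instance : NoZeroDivisors Eisenstein where
  eq_zero_or_eq_zero_of_mul_eq_zero {a b} h := by
    have h' : norm a * norm b = 0 := by rw [← map_mul, h, QuadraticAlgebra.norm_zero]
    exact (mul_eq_zero.mp h').imp eq_zero_of_norm_eq_zero eq_zero_of_norm_eq_zero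

instance : IsDomain Eisenstein := NoZeroDivisors.to_isDomain _

lemma root_pow_three : root ^ 3 = 1 := by decide

lemma root_sq_add_root_add_one : root ^ 2 + root + 1 = 0 := by decide

lemma re_im_of_isUnit {z : Eisenstein} (hz : IsUnit z) :
    (z.re = 1 ∧ z.im = 0) ∨ (z.re = -1 ∧ z.im = 0) ∨ (z.re = 0 ∧ z.im = 1) ∨
      (z.re = 0 ∧ z.im = -1) ∨ (z.re = 1 ∧ z.im = 1) ∨ (z.re = -1 ∧ z.im = -1) := by
  have h := isUnit_iff_norm_isUnit.mp hz
  rw [norm_eq, Int.isUnit_iff] at h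
  obtain ⟨a, b⟩ := z
  dsimp only at h ⊢
  have ha : a ^ 2 ≤ 1 := by rcases h with h | h <;> nlinarith [sq_nonneg (2 * b - a)]
  have hb : b ^ 2 ≤ 1 := by rcases h with h | h <;> nlinarith [sq_nonneg (2 * a - b)]
  have ha₁ : a ≤ 1 := by nlinarith
  have ha₂ : -1 ≤ a := by nlinarith
  have hb₁ : b ≤ 1 := by nlinarith
  have hb₂ : -1 ≤ b := by nlinarith
  interval_cases a <;> interval_cases b <;> simp_all

/-- Reduction modulo `ω - 1`. -/
lemma re_add_im_sign_mul_root_pow (a k : ℕ) :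
    (((-1) ^ a * root ^ k).re : ZMod 3) + (((-1) ^ a * root ^ k).im : ZMod 3) = (-1) ^ a := by
  rw [← Nat.div_add_mod k 3, pow_add, pow_mul, root_pow_three, one_pow, one_mul]
  have hk := Nat.mod_lt k (by norm_num : 3 > 0)
  rcases Nat.even_or_odd a with h | h <;> rw [h.neg_one_pow, h.neg_one_pow] <;>
  interval_cases k % 3 <;> decide

/-- Reduction modulo `3` of the `ω`-coordinate. -/
lemma im_sign_mul_root_pow (a k : ℕ) :
    (((-1) ^ a * root ^ k).im : ZMod 3) = (-1) ^ a * k := by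
  rw [← ZMod.natCast_mod k 3]
  nth_rw 1 [← Nat.div_add_mod k 3]
  rw [pow_add, pow_mul, root_pow_three, one_pow, one_mul]
  have hk := Nat.mod_lt k (by norm_num : 3 > 0)
  rcases Nat.even_or_odd a with h | h <;> rw [h.neg_one_pow, h.neg_one_pow] <;>
  interval_cases k % 3 <;> decide

lemma exists_sign {z : Eisenstein} (hz : IsUnit z) :
    ∃ e : ZMod 2, (z.re : ZMod 3) + (z.im : ZMod 3) = (-1) ^ e.val := by
  rcases re_im_of_isUnit hz with h | h | h | h | h | h <;> rw [h.1, h.2] <;> decide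

lemma eq_sign_mul_root_pow {z : Eisenstein} (hz : IsUnit z) {a k : ℕ}
    (hs : (z.re : ZMod 3) + (z.im : ZMod 3) = (-1) ^ a) (hk : (z.im : ZMod 3) = (-1) ^ a * k) :
    z = (-1) ^ a * root ^ k := by
  rw [← ZMod.natCast_mod k 3] at hk
  rw [← Nat.div_add_mod k 3, pow_add, pow_mul, root_pow_three, one_pow, one_mul]
  have hk' := Nat.mod_lt k (by norm_num : 3 > 0)
  have hz' := re_im_of_isUnit hz
  obtain ⟨x, y⟩ := z
  dsimp only at hz' hs hk
  rcases Nat.even_or_odd a with h | h <;> rw [h.neg_one_pow] at hs hk ⊢ <;>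
  rcases hz' with ⟨rfl, rfl⟩ | ⟨rfl, rfl⟩ | ⟨rfl, rfl⟩ | ⟨rfl, rfl⟩ | ⟨rfl, rfl⟩ | ⟨rfl, rfl⟩ <;>
  interval_cases k % 3 <;> revert hs hk <;> decide

/-- The evaluation `x_i ↦ ω ^ (s i)`. -/
noncomputable def evalRoot {σ : Type*} (s : σ → ℕ) : MvPolynomial σ ℤ →+* Eisenstein :=
  eval₂Hom (Int.castRingHom Eisenstein) fun i => root ^ s i

@[simp]
lemma evalRoot_X {σ : Type*} (s : σ → ℕ) (i : σ) : evalRoot s (X i) = root ^ s i := by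
  simp [evalRoot]

/-- Modulo `3 = -ω²(ω - 1)²`, the value at `(ω ^ s i)` is given by a Taylor expansion at `1`. -/
lemma exists_taylor {σ : Type*} [Fintype σ] (p : MvPolynomial σ ℤ) :
    ∃ (c : ZMod 3) (d : σ → ZMod 3), ∀ s : σ → ℕ,
      ((evalRoot s p).re : ZMod 3) + ((evalRoot s p).im : ZMod 3) = c ∧
        ((evalRoot s p).im : ZMod 3) = ∑ i, s i * d i := by
  classical
  induction p using MvPolynomial.induction_on with
  | C a => exact ⟨a, 0, fun s => by simp [evalRoot]⟩
  | add p q hp hq =>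
    obtain ⟨c, d, h⟩ := hp
    obtain ⟨c', d', h'⟩ := hq
    refine ⟨c + c', d + d', fun s => ⟨?_, ?_⟩⟩
    · rw [← (h s).1, ← (h' s).1, map_add, re_add, im_add]
      push_cast
      ring
    · simp [mul_add, Finset.sum_add_distrib, ← (h s).2, ← (h' s).2]
  | mul_X p k hp =>
    obtain ⟨c, d, h⟩ := hp
    refine ⟨c, d + Pi.single k c, fun s => ?_⟩
    have h₁ := re_add_im_sign_mul_root_pow 0 (s k)
    have h₂ := im_sign_mul_root_pow 0 (s k)
    simp only [pow_zero, one_mul] at h₁ h₂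
    obtain ⟨h₃, h₄⟩ := h s
    simp only [Pi.add_apply, mul_add, Finset.sum_add_distrib, ← h₄, Pi.single_apply, mul_ite,
      mul_zero, Finset.sum_ite_eq', Finset.mem_univ, if_true, map_mul, evalRoot_X, ← h₃, ← h₂,
      re_mul, im_mul]
    push_cast
    have h₀ : (3 : ZMod 3) = 0 := rfl
    rw [← eq_sub_iff_add_eq] at h₁
    rw [h₁]
    constructor
    · linear_combination (-((evalRoot s p).im : ZMod 3) * ((root ^ s k).im : ZMod 3)) * h₀
    · linear_combination (-((evalRoot s p).im : ZMod 3) * ((root ^ s k).im : ZMod 3)) * h₀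

end Eisenstein

open MvPolynomial Eisenstein

lemma evalRoot_eq_zero_of_mem {n : ℕ} {s : Fin (n + 1) → ℕ} (hs : ∀ i, s i = 1 ∨ s i = 2)
    {p : MvPolynomial (Fin (n + 1)) ℤ} (hp : p ∈ stmt9Ideal n) : evalRoot s p = 0 := by
  suffices h : stmt9Ideal n ≤ RingHom.ker (evalRoot s) from h hp
  refine Ideal.span_le.mpr ?_
  rintro _ ⟨i, rfl⟩
  rw [SetLike.mem_coe, RingHom.mem_ker]
  simp only [map_add, map_pow, map_one, evalRoot_X]
  rcases hs i with h | h <;> rw [h] <;> decide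

/-- A polynomial vanishing at all tuples of primitive cube roots of unity lies in the ideal. -/
lemma mem_stmt9Ideal {n : ℕ} {p : MvPolynomial (Fin (n + 1)) ℤ}
    (hp : ∀ s : Fin (n + 1) → ℕ, (∀ i, s i = 1 ∨ s i = 2) → evalRoot s p = 0) :
    p ∈ stmt9Ideal n := by
  let m : MonomialOrder (Fin (n + 1)) := .lex
  let b : Fin (n + 1) → MvPolynomial (Fin (n + 1)) ℤ := fun i => X i ^ 2 + X i + 1
  have hsq (i : Fin (n + 1)) : m.degree (X i ^ 2 : MvPolynomial (Fin (n + 1)) ℤ) =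
      Finsupp.single i 2 := by
    rw [m.degree_pow, m.degree_X, Finsupp.smul_single, smul_eq_mul, mul_one]
  have hlt₁ (i : Fin (n + 1)) : m.toSyn (m.degree (X i : MvPolynomial (Fin (n + 1)) ℤ)) <
      m.toSyn (m.degree (X i ^ 2 : MvPolynomial (Fin (n + 1)) ℤ)) := by
    rw [hsq, m.degree_X]
    exact m.toSyn_strictMono ((Finsupp.single_mono one_le_two).lt_of_ne
      ((Finsupp.single_injective i).ne (by norm_num)))
  have hlt₂ (i : Fin (n + 1)) : m.toSyn (m.degree (1 : MvPolynomial (Fin (n + 1)) ℤ)) <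
      m.toSyn (m.degree (X i ^ 2 + X i : MvPolynomial (Fin (n + 1)) ℤ)) := by
    rw [m.degree_add_of_lt (hlt₁ i), hsq, m.degree_one]
    exact m.toSyn_strictMono (pos_iff_ne_zero.mpr (by simp))
  have hdeg (i : Fin (n + 1)) : m.degree (b i) = Finsupp.single i 2 := by
    rw [m.degree_add_of_lt (hlt₂ i), m.degree_add_of_lt (hlt₁ i), hsq]
  have hmonic (i : Fin (n + 1)) : m.Monic (b i) :=
    (m.monic_X.pow.add_of_lt (hlt₁ i)).add_of_lt (hlt₂ i)
  obtain ⟨g, r, hpr, -, hr⟩ := m.div (b := b) (fun i => by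
    rw [(hmonic i).leadingCoeff_eq_one]; exact isUnit_one) p
  have hmem : Finsupp.linearCombination _ b g ∈ stmt9Ideal n := by
    rw [Finsupp.linearCombination_apply]
    exact Submodule.sum_mem _ fun i _ =>
      Submodule.smul_mem _ _ (Ideal.subset_span ⟨i, rfl⟩)
  suffices hr0 : r = 0 by rw [hpr, hr0, add_zero]; exact hmem
  have hinj : Function.Injective (Int.castRingHom Eisenstein) := Int.cast_injective
  apply map_injective _ hinj
  rw [map_zero]
  have hne : (root : Eisenstein) ≠ root ^ 2 := by decide
  refine eq_zero_of_eval_zero_at_prod_finset _ (fun _ => {root, root ^ 2}) (fun i => ?_)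
    fun x hx => ?_
  · rw [Finset.card_pair hne, degreeOf_lt_iff two_pos, support_map_of_injective _ hinj]
    intro c hc
    by_contra! hci
    exact hr c hc i (by rw [hdeg]; exact Finsupp.single_le_iff.mpr hci)
  · have hs (i : Fin (n + 1)) : ∃ k : ℕ, (k = 1 ∨ k = 2) ∧ x i = root ^ k := by
      rcases Finset.mem_insert.mp (hx i) with h | h
      · exact ⟨1, .inl rfl, by rw [h, pow_one]⟩
      · exact ⟨2, .inr rfl, Finset.mem_singleton.mp h⟩
    choose s hs hxs using hs
    obtain rfl : x = fun i => root ^ s i := funext hxs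
    rw [eval_map]
    have h := hp s hs
    rw [hpr, map_add, evalRoot_eq_zero_of_mem hs hmem, zero_add] at h
    exact h

/-- The evaluation `x_i ↦ ω ^ (s i)` on the quotient ring. -/
noncomputable def evalQuot {n : ℕ} (s : Fin (n + 1) → ℕ) (hs : ∀ i, s i = 1 ∨ s i = 2) :
    MvPolynomial (Fin (n + 1)) ℤ ⧸ stmt9Ideal n →+* Eisenstein :=
  Ideal.Quotient.lift _ (evalRoot s) fun _ => evalRoot_eq_zero_of_mem hs

lemma eq_of_evalQuot_eq {n : ℕ} {a b : MvPolynomial (Fin (n + 1)) ℤ ⧸ stmt9Ideal n}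
    (h : ∀ s hs, evalQuot s hs a = evalQuot s hs b) : a = b := by
  obtain ⟨p, rfl⟩ := Ideal.Quotient.mk_surjective a
  obtain ⟨q, rfl⟩ := Ideal.Quotient.mk_surjective b
  refine Ideal.Quotient.eq.mpr (mem_stmt9Ideal fun s hs => ?_)
  rw [map_sub, sub_eq_zero]
  exact h s hs

/-- The homomorphism from the cyclic group of order `k` given by an element of exponent `k`. -/
def powZModHom {G : Type*} [Monoid G] {k : ℕ} [NeZero k] (u : G) (hu : u ^ k = 1) :
    Multiplicative (ZMod k) →* G where
  toFun j := u ^ (Multiplicative.toAdd j).val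
  map_one' := by simp
  map_mul' i j := by
    rw [toAdd_mul, ZMod.val_add, ← pow_eq_pow_mod _ hu, pow_add]

/-- The homomorphism `(e, j) ↦ v ^ e * ∏ u_i ^ j_i` for `v` of exponent `k`, `u_i` of exponent `l`. -/
def powZModProdHom {ι G : Type*} [Fintype ι] [CommMonoid G] {k l : ℕ} [NeZero k] [NeZero l]
    (v : G) (hv : v ^ k = 1) (u : ι → G) (hu : ∀ i, u i ^ l = 1) :
    Multiplicative (ZMod k) × (ι → Multiplicative (ZMod l)) →* G :=
  (powZModHom v hv).comp (MonoidHom.fst _ _) *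
    ∏ i, (powZModHom (u i) (hu i)).comp ((Pi.evalMonoidHom _ i).comp (MonoidHom.snd _ _))

lemma powZModProdHom_apply {ι G : Type*} [Fintype ι] [CommMonoid G] {k l : ℕ} [NeZero k]
    [NeZero l] (v : G) (hv : v ^ k = 1) (u : ι → G) (hu : ∀ i, u i ^ l = 1)
    (x : Multiplicative (ZMod k) × (ι → Multiplicative (ZMod l))) :
    powZModProdHom v hv u hu x =
      v ^ (Multiplicative.toAdd x.1).val * ∏ i, u i ^ (Multiplicative.toAdd (x.2 i)).val := by
  simp [powZModProdHom, powZModHom, MonoidHom.finsetProd_apply]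

/-- The class of `x_i` as a unit of the quotient ring. -/
noncomputable def rootUnit {n : ℕ} (i : Fin (n + 1)) :
    (MvPolynomial (Fin (n + 1)) ℤ ⧸ stmt9Ideal n)ˣ :=
  Units.ofPowEqOne (Ideal.Quotient.mk _ (X i)) 3
    (by
      rw [← map_pow, ← map_one (Ideal.Quotient.mk _), Ideal.Quotient.eq]
      have h : (X i ^ 3 - 1 : MvPolynomial (Fin (n + 1)) ℤ) =
        (X i - 1) * (X i ^ 2 + X i + 1) := by ring
      rw [h]
      exact Ideal.mul_mem_left _ _ (Ideal.subset_span ⟨i, rfl⟩))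
    (by norm_num)

lemma rootUnit_pow_three {n : ℕ} (i : Fin (n + 1)) : rootUnit i ^ 3 = 1 :=
  Units.pow_ofPowEqOne _ _

/-- The homomorphism `(e, j) ↦ (-1) ^ e * ∏ x_i ^ j_i`. -/
noncomputable def signRootHom (n : ℕ) :
    Multiplicative (ZMod 2) × (Fin (n + 1) → Multiplicative (ZMod 3)) →*
      (MvPolynomial (Fin (n + 1)) ℤ ⧸ stmt9Ideal n)ˣ :=
  powZModProdHom (-1) neg_one_sq rootUnit rootUnit_pow_three

lemma evalQuot_signRootHom {n : ℕ} (s : Fin (n + 1) → ℕ) (hs : ∀ i, s i = 1 ∨ s i = 2)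
    (x : Multiplicative (ZMod 2) × (Fin (n + 1) → Multiplicative (ZMod 3))) :
    evalQuot s hs (signRootHom n x) =
      (-1) ^ (Multiplicative.toAdd x.1).val *
        root ^ ∑ i, s i * (Multiplicative.toAdd (x.2 i)).val := by
  have h (i : Fin (n + 1)) : evalQuot s hs (rootUnit i) = root ^ s i := evalRoot_X s i
  simp [signRootHom, powZModProdHom_apply, h, Finset.prod_pow_eq_pow_sum, ← pow_mul]

lemma signRootHom_injective (n : ℕ) : Function.Injective (signRootHom n) := by
  rw [injective_iff_map_eq_one]
  rintro ⟨e, j⟩ hx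
  have h (s : Fin (n + 1) → ℕ) (hs : ∀ i, s i = 1 ∨ s i = 2) :=
    (evalQuot_signRootHom s hs (e, j)).symm
  simp only [hx, Units.val_one, map_one] at h
  have he : e = 1 := by
    have h₁ := re_add_im_sign_mul_root_pow (Multiplicative.toAdd e).val
      (∑ i, 1 * (Multiplicative.toAdd (j i)).val)
    rw [h (fun _ => 1) fun _ => .inl rfl] at h₁
    have h₂ : ∀ e' : ZMod 2, ((1 : Eisenstein).re : ZMod 3) + ((1 : Eisenstein).im : ZMod 3) =
        (-1) ^ e'.val → e' = 0 := by decide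
    exact toAdd_eq_zero.mp (h₂ _ h₁)
  subst he
  have hsum (s : Fin (n + 1) → ℕ) (hs : ∀ i, s i = 1 ∨ s i = 2) :
      ∑ i, (s i : ZMod 3) * Multiplicative.toAdd (j i) = 0 := by
    have h₁ := im_sign_mul_root_pow 0 (∑ i, s i * (Multiplicative.toAdd (j i)).val)
    have h₂ := h s hs
    simp only [toAdd_one, ZMod.val_zero] at h₂
    rw [h₂] at h₁
    simpa [QuadraticAlgebra.im_one] using h₁.symm
  refine Prod.ext rfl (funext fun k => ?_)
  have h₁ := hsum (fun _ => 1) fun _ => .inl rfl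
  have h₂ := hsum (fun i => if i = k then 2 else 1) fun i => by split_ifs <;> simp
  rw [← h₁, ← sub_eq_zero, ← Finset.sum_sub_distrib, Finset.sum_eq_single k] at h₂
  · refine toAdd_eq_zero.mp ?_
    rw [← h₂, if_pos rfl]
    push_cast
    ring
  · intro i _ hik
    rw [if_neg hik, sub_self]
  · simp

lemma signRootHom_surjective (n : ℕ) : Function.Surjective (signRootHom n) := by
  intro u
  obtain ⟨p, hp⟩ := Ideal.Quotient.mk_surjective (u : MvPolynomial (Fin (n + 1)) ℤ ⧸ stmt9Ideal n)
  have heval (s : Fin (n + 1) → ℕ) (hs : ∀ i, s i = 1 ∨ s i = 2) :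
      evalQuot s hs u = evalRoot s p := by rw [← hp]; rfl
  have hunit (s : Fin (n + 1) → ℕ) (hs : ∀ i, s i = 1 ∨ s i = 2) : IsUnit (evalRoot s p) := by
    rw [← heval s hs]
    exact u.isUnit.map _
  obtain ⟨c, d, hcd⟩ := exists_taylor p
  obtain ⟨e, he⟩ := exists_sign (hunit (fun _ => 1) fun _ => .inl rfl)
  rw [(hcd _).1] at he
  refine ⟨(.ofAdd e, fun i => .ofAdd ((-1) ^ e.val * d i)), Units.ext (eq_of_evalQuot_eq ?_)⟩
  intro s hs
  rw [evalQuot_signRootHom, heval]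
  refine (eq_sign_mul_root_pow (hunit s hs) ((hcd s).1.trans he) ?_).symm
  rw [(hcd s).2]
  push_cast
  rw [Finset.mul_sum]
  refine Finset.sum_congr rfl fun i _ => ?_
  simp only [toAdd_ofAdd, ZMod.natCast_val, ZMod.cast_id]
  rw [mul_left_comm, ← mul_assoc ((-1) ^ _), ← mul_pow]
  simp

/-- The ring `A_n = ℤ[x_0, …, x_n]/(x_i² + x_i + 1)` is reduced, torsion-free, and its
unit group is isomorphic to `ℤ/2ℤ × (ℤ/3ℤ)^{n+1}`. -/
theorem stmt_9 (n : ℕ) :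
    IsReduced (MvPolynomial (Fin (n + 1)) ℤ ⧸ stmt9Ideal n) ∧
    (∀ (k : ℕ) (a : MvPolynomial (Fin (n + 1)) ℤ ⧸ stmt9Ideal n),
        0 < k → k • a = 0 → a = 0) ∧
    Nonempty ((MvPolynomial (Fin (n + 1)) ℤ ⧸ stmt9Ideal n)ˣ ≃*
        Multiplicative (ZMod 2) × (Fin (n + 1) → Multiplicative (ZMod 3))) := by
  have hzero {a : MvPolynomial (Fin (n + 1)) ℤ ⧸ stmt9Ideal n}
      (h : ∀ s hs, evalQuot s hs a = 0) : a = 0 :=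
    eq_of_evalQuot_eq fun s hs => by rw [h s hs, map_zero]
  refine ⟨⟨fun a ⟨k, hk⟩ => hzero fun s hs => ?_⟩, fun k a hk ha => hzero fun s hs => ?_,
    ⟨(MulEquiv.ofBijective (signRootHom n)
      ⟨signRootHom_injective n, signRootHom_surjective n⟩).symm⟩⟩
  · exact eq_zero_of_pow_eq_zero (by rw [← map_pow, hk, map_zero])
  · have h : k • evalQuot s hs a = 0 := by rw [← map_nsmul, ha, map_zero]
    exact (smul_eq_zero.mp h).resolve_left hk.ne'
end

section
/- Let A be a commutative ring with identity of characteristic 0 whose group of units A* is finite. Then there is no element α ∈ A* with α^4 = −1. (Consequently the minimal order of a cyclic direct factor in the 2-Sylow subgroup of A* is at most 4.) -/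
/-- Every positive power of `1 + s`, where `s ^ 2 = 2`, has the form `a + b * s` with `0 < b`. -/
theorem exists_one_add_pow_eq_of_sq_eq_two {A : Type*} [CommRing A] {s : A} (hs : s ^ 2 = 2)
    (n : ℕ) : ∃ a b : ℕ, 0 < b ∧ (1 + s) ^ (n + 1) = a + b * s := by
  induction n with
  | zero => exact ⟨1, 1, one_pos, by simp⟩
  | succ n ih =>
    obtain ⟨a, b, hb, h⟩ := ih
    refine ⟨a + 2 * b, a + b, by omega, ?_⟩
    rw [pow_succ, h]
    push_cast
    linear_combination (b : A) * hs

theorem Int.eq_zero_of_sq_eq_two_mul_sq {x y : ℤ} (h : x ^ 2 = 2 * y ^ 2) : y = 0 := by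
  by_contra hy
  have hy' : (y : ℝ) ≠ 0 := by exact_mod_cast hy
  have h' : (x : ℝ) ^ 2 = 2 * (y : ℝ) ^ 2 := by exact_mod_cast h
  refine irrational_sqrt_two ⟨|(x / y : ℚ)|, ?_⟩
  push_cast
  rw [← Real.sqrt_sq_eq_abs, div_pow, h', mul_div_cancel_right₀ _ (pow_ne_zero 2 hy')]

/-- Let `A` be a commutative ring of characteristic 0 whose group of units is finite.
Then there is no unit `α` with `α ^ 4 = -1`. -/
theorem stmt_11 (A : Type*) [CommRing A] [CharZero A] [Finite Aˣ] :
    ¬ ∃ α : Aˣ, α ^ 4 = -1 := by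
  rintro ⟨α, hα⟩
  have h4 : (α : A) ^ 4 = -1 := by simpa using congrArg Units.val hα
  obtain ⟨s, hs⟩ : ∃ s : A, s ^ 2 = 2 :=
    ⟨α - α ^ 3, by linear_combination ((α : A) ^ 2 - 2) * h4⟩
  let u : Aˣ := ⟨1 + s, s - 1, by linear_combination hs, by linear_combination hs⟩
  obtain ⟨n, hn, hu⟩ := (isOfFinOrder_of_finite u).exists_pow_eq_one
  obtain ⟨a, b, hb, hab⟩ := exists_one_add_pow_eq_of_sq_eq_two hs (n - 1)
  rw [Nat.sub_add_cancel hn] at hab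
  have h1 : (1 + s) ^ n = 1 := by simpa [u] using congrArg Units.val hu
  have key : (((a : ℤ) - 1) ^ 2 : ℤ) = 2 * (b : ℤ) ^ 2 := by
    have : ((((a : ℤ) - 1) ^ 2 : ℤ) : A) = ((2 * (b : ℤ) ^ 2 : ℤ) : A) := by
      push_cast
      linear_combination (a - 1 - b * s : A) * (h1 - hab) + (b : A) ^ 2 * hs
    exact_mod_cast this
  have := Int.eq_zero_of_sq_eq_two_mul_sq key
  omega
end

section
/- Let A be a commutative ring with identity of characteristic 0 whose group of units A* is finite. Then there exists a finite abelian group H such that either A* ≅ ℤ/2ℤ × H or A* ≅ ℤ/4ℤ × H. -/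
/-- In `ZMod (p ^ e)` with `p ^ e ≠ 2, 4`, every 2-torsion element is divisible by 4. -/
theorem ZMod.exists_four_nsmul_eq_of_two_nsmul_eq_zero {p e : ℕ} (hp : p.Prime)
    (h2 : p ^ e ≠ 2) (h4 : p ^ e ≠ 4) (x : ZMod (p ^ e)) (hx : 2 • x = 0) :
    ∃ y, x = 4 • y := by
  have : NeZero (p ^ e) := ⟨(pow_pos hp.pos e).ne'⟩
  have hdvd : p ^ e ∣ 2 * x.val := by
    rw [← ZMod.natCast_eq_zero_iff]
    simpa using hx
  have hcases : Odd (p ^ e) ∨ 8 ∣ p ^ e := by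
    rcases hp.eq_two_or_odd' with rfl | hodd
    · match e, h2, h4 with
      | 0, _, _ => simp
      | 1, h, _ => simp at h
      | 2, _, h => simp at h
      | k + 3, _, _ => exact Or.inr ⟨2 ^ k, by ring⟩
    · exact Or.inl hodd.pow
  rcases hcases with hodd | ⟨m, hm⟩
  · have hval : p ^ e ∣ x.val :=
      (Nat.Coprime.dvd_mul_left (Nat.coprime_two_right.2 hodd)).1 hdvd
    refine ⟨0, ?_⟩
    rw [smul_zero, ← ZMod.natCast_zmod_val x, ZMod.natCast_eq_zero_iff]
    exact hval
  · obtain ⟨c, hc⟩ := hdvd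
    refine ⟨((m * c : ℕ) : ZMod (p ^ e)), ?_⟩
    have hval : x.val = 4 * (m * c) := by
      have h8 : 2 * x.val = 8 * m * c := by rw [hc, hm]
      linarith
    rw [← ZMod.natCast_zmod_val x, hval]
    simp

/-- A finite commutative group containing an involution which is not a fourth power
has a cyclic direct factor of order 2 or 4. -/
theorem CommGroup.exists_mulEquiv_zmod_two_or_four_prod {G : Type*} [CommGroup G] [Finite G]
    (z : G) (hz : z ^ 2 = 1) (hz4 : ∀ u : G, u ^ 4 ≠ z) :
    ∃ (H : Type) (_ : CommGroup H), Finite H ∧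
      (Nonempty (G ≃* Multiplicative (ZMod 2) × H) ∨
        Nonempty (G ≃* Multiplicative (ZMod 4) × H)) := by
  classical
  obtain ⟨ι, _, p, hp, e, ⟨f⟩⟩ := AddCommGroup.equiv_directSum_zmod_of_finite (Additive G)
  let g : Additive G ≃+ (∀ i, ZMod (p i ^ e i)) := f.trans (DirectSum.addEquivProd _)
  have hne : ∀ i, NeZero (p i ^ e i) := fun i => ⟨(pow_pos (hp i).pos _).ne'⟩
  obtain ⟨i, hi⟩ : ∃ i, p i ^ e i = 2 ∨ p i ^ e i = 4 := by
    by_contra! hcon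
    have hg : 2 • g (Additive.ofMul z) = 0 := by
      rw [← map_nsmul, ← ofMul_pow, hz, ofMul_one, map_zero]
    choose y hy using fun i => ZMod.exists_four_nsmul_eq_of_two_nsmul_eq_zero (hp i)
      (hcon i).1 (hcon i).2 (g (Additive.ofMul z) i) (congrFun hg i)
    refine hz4 (g.symm y).toMul (Additive.ofMul.injective ?_)
    rw [ofMul_pow, ofMul_toMul, ← map_nsmul, AddEquiv.symm_apply_eq]
    exact (funext hy).symm
  let s : Additive G ≃+ ZMod (p i ^ e i) × (∀ j : {j // j ≠ i}, ZMod (p j ^ e j)) :=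
    g.trans { Equiv.piSplitAt i (fun j => ZMod (p j ^ e j)) with map_add' := fun _ _ => rfl }
  have key : ∀ n, p i ^ e i = n → Nonempty
      (G ≃* Multiplicative (ZMod n) × Multiplicative (∀ j : {j // j ≠ i}, ZMod (p j ^ e j))) := by
    rintro n rfl
    exact ⟨(AddEquiv.toMultiplicativeRight s).trans (MulEquiv.prodMultiplicative _ _)⟩
  exact ⟨Multiplicative (∀ j : {j // j ≠ i}, ZMod (p j ^ e j)), inferInstance,
    inferInstance, hi.imp (key 2) (key 4)⟩

/-- Positive powers of `1 + √2` have positive coordinates. -/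
theorem Zsqrtd.re_pos_and_im_pos_one_add_sqrt_two_pow (n : ℕ) :
    0 < ((⟨1, 1⟩ : ℤ√2) ^ (n + 1)).re ∧ 0 < ((⟨1, 1⟩ : ℤ√2) ^ (n + 1)).im := by
  induction n with
  | zero => simp
  | succ n ih =>
    rw [pow_succ, Zsqrtd.re_mul, Zsqrtd.im_mul]
    constructor <;> linarith [ih.1, ih.2]

/-- A commutative ring of characteristic zero with a square root of two has infinitely many
units. -/
theorem infinite_units_of_mul_self_eq_two {A : Type*} [CommRing A] [CharZero A] (s : A)
    (hs : s * s = 2) : Infinite Aˣ := by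
  by_contra hfin
  rw [not_infinite_iff_finite] at hfin
  let φ : ℤ√2 →+* A := Zsqrtd.lift ⟨s, by simpa using hs⟩
  have hφ : Function.Injective φ := by
    refine Zsqrtd.lift_injective _ fun n hn => ?_
    have h1 : n < 2 := by nlinarith
    have h2 : -2 < n := by nlinarith
    interval_cases n <;> omega
  let w : Aˣ := Units.mkOfMulEqOne (1 + s) (s - 1) (by linear_combination hs)
  have hw : φ ⟨1, 1⟩ = w := by simp [φ, w]
  obtain ⟨n, hn, hwn⟩ := isOfFinOrder_iff_pow_eq_one.1 (isOfFinOrder_of_finite w)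
  obtain ⟨k, rfl⟩ := Nat.exists_eq_succ_of_ne_zero hn.ne'
  have hone : (⟨1, 1⟩ : ℤ√2) ^ (k + 1) = 1 := by
    apply hφ
    rw [map_pow, hw, map_one]
    exact congrArg Units.val hwn
  have him := (Zsqrtd.re_pos_and_im_pos_one_add_sqrt_two_pow k).2
  rw [hone] at him
  simp at him

/-- Let `A` be a commutative ring of characteristic 0 with finite unit group. Then
`Aˣ ≅ ℤ/2ℤ × H` or `Aˣ ≅ ℤ/4ℤ × H` for some finite abelian group `H`. -/
theorem stmt_12 (A : Type*) [CommRing A] [CharZero A] [Finite Aˣ] :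
    ∃ (H : Type) (_ : CommGroup H), Finite H ∧
      (Nonempty (Aˣ ≃* Multiplicative (ZMod 2) × H) ∨
        Nonempty (Aˣ ≃* Multiplicative (ZMod 4) × H)) := by
  refine CommGroup.exists_mulEquiv_zmod_two_or_four_prod (-1) (by simp) fun u hu => ?_
  have hu4 : (u : A) ^ 4 = -1 := by simpa using congrArg Units.val hu
  refine not_finite_iff_infinite.2 (infinite_units_of_mul_self_eq_two ((u : A) - u ^ 3) ?_) ‹_›
  linear_combination ((u : A) ^ 2 - 2) * hu4
end

section
/- For every finite abelian group H there exists a commutative ring A with identity of characteristic 0 such that A* ≅ ℤ/2ℤ × H. (For H ≅ ℤ/a₁ℤ × ⋯ × ℤ/a_nℤ one may take A = ℤ[x_1,…,x_n]/(a_i x_i, x_i x_j : 1 ≤ i, j ≤ n).) -/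
open TrivSqZeroExt in
/-- The unipotent units `1 + m` of a trivial square-zero extension. -/
def TrivSqZeroExt.unipotentUnit (R M : Type*) [CommRing R] [AddCommGroup M] [Module R M]
    [Module Rᵐᵒᵖ M] [IsCentralScalar R M] : Multiplicative M →* (TrivSqZeroExt R M)ˣ :=
  MonoidHom.toHomUnits
    { toFun := fun m => 1 + inr m.toAdd
      map_one' := by simp
      map_mul' := fun a b => by ext <;> simp [add_comm] }

open TrivSqZeroExt in
/-- The unit group of a trivial square-zero extension is `Rˣ × M`. -/
noncomputable def TrivSqZeroExt.unitsMulEquiv (R M : Type*) [CommRing R] [AddCommGroup M]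
    [Module R M] [Module Rᵐᵒᵖ M] [IsCentralScalar R M] :
    Rˣ × Multiplicative M ≃* (TrivSqZeroExt R M)ˣ :=
  MulEquiv.ofBijective
    ((Units.map (inlHom R M : R →* TrivSqZeroExt R M)).coprod (unipotentUnit R M)) <| by
    constructor
    · rw [injective_iff_map_eq_one]
      rintro ⟨r, m⟩ h
      have h' := congrArg Units.val h
      have h1 := congrArg fst h'
      have h2 := congrArg snd h'
      simp [unipotentUnit] at h1 h2
      subst h1
      simpa using h2
    · intro u
      let r : Rˣ := Units.map (fstHom R R M : TrivSqZeroExt R M →* R) u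
      refine ⟨(r, Multiplicative.ofAdd (r⁻¹ • (u : TrivSqZeroExt R M).snd)), Units.ext ?_⟩
      have hr : (u : TrivSqZeroExt R M).fst = r := rfl
      ext
      · simp [unipotentUnit, hr]
      · simp [unipotentUnit, Units.smul_def, smul_smul]

/-- For every finite abelian group `H` there is a commutative ring `A` of
characteristic 0 with `Aˣ ≅ ℤ/2ℤ × H`. -/
theorem stmt_13 (H : Type) [CommGroup H] [Finite H] :
    ∃ (A : Type) (_ : CommRing A), CharZero A ∧
      Nonempty (Aˣ ≃* Multiplicative (ZMod 2) × H) := by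
  let : Module ℤᵐᵒᵖ (Additive H) :=
    Module.compHom _ ((RingHom.id ℤ).fromOpposite fun _ _ => Commute.all _ _)
  have : IsCentralScalar ℤ (Additive H) := ⟨fun _ _ => rfl⟩
  refine ⟨TrivSqZeroExt ℤ (Additive H), inferInstance, ⟨fun a b h => ?_⟩, ⟨?_⟩⟩
  · simpa using congrArg TrivSqZeroExt.fst h
  · have : Fact (Nat.Prime 2) := ⟨Nat.prime_two⟩
    have e : ℤˣ ≃* Multiplicative (ZMod 2) :=
      mulEquivOfPrimeCardEq (p := 2) (by simp) (by simp)
    exact (TrivSqZeroExt.unitsMulEquiv ℤ (Additive H)).symm.trans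
      (e.prodCongr (MulEquiv.refl H))
end

section
/- A positive integer n is the cardinality of the (finite) group of units of some commutative ring with identity of characteristic 0 if and only if n is even. -/
theorem even_card_units_of_charZero (A : Type*) [CommRing A] [CharZero A] :
    Even (Nat.card Aˣ) := by
  have h : orderOf (-1 : Aˣ) = 2 := by
    refine orderOf_eq_prime (by simp) fun h => ?_
    have h' : (-1 : A) = 1 := by simpa using congrArg Units.val h
    have h2 : ((2 : ℕ) : A) = 0 := by
      push_cast
      linear_combination -h'
    exact two_ne_zero (Nat.cast_eq_zero.mp h2)
  exact even_iff_two_dvd.mpr (h ▸ orderOf_dvd_natCard (-1 : Aˣ))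

theorem TrivSqZeroExt.card_units (R M : Type*) [CommRing R] [AddCommGroup M] [Module R M]
    [Module Rᵐᵒᵖ M] [IsCentralScalar R M] :
    Nat.card (TrivSqZeroExt R M)ˣ = Nat.card Rˣ * Nat.card M := by
  rw [← Nat.card_prod]
  refine Nat.card_congr (Equiv.ofBijective
    (fun u => (Units.map (TrivSqZeroExt.fstHom R R M).toMonoidHom u, (u : TrivSqZeroExt R M).snd))
    ⟨fun u v h => ?_, fun ⟨r, m⟩ => ?_⟩)
  · obtain ⟨h1, h2⟩ := Prod.ext_iff.mp h
    exact Units.ext (TrivSqZeroExt.ext (congrArg Units.val h1) h2)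
  · have hu : IsUnit (TrivSqZeroExt.inl (r : R) + TrivSqZeroExt.inr m) :=
      TrivSqZeroExt.isUnit_iff_isUnit_fst.mpr (by simp)
    refine ⟨hu.unit, Prod.ext (Units.ext ?_) ?_⟩ <;> simp

/-- A positive integer `n` is the cardinality of the (finite) unit group of some
commutative ring of characteristic 0 if and only if `n` is even. -/
theorem stmt_14 (n : ℕ) (hn : 0 < n) :
    (∃ (A : Type) (_ : CommRing A), CharZero A ∧ Finite Aˣ ∧ Nat.card Aˣ = n) ↔
      Even n := by
  constructor
  · rintro ⟨A, _, _, -, rfl⟩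
    exact even_card_units_of_charZero A
  · rintro ⟨m, rfl⟩
    let : Module ℤᵐᵒᵖ (ZMod m) :=
      Module.compHom _ ((RingHom.id ℤ).fromOpposite fun _ _ => mul_comm _ _)
    have : IsCentralScalar ℤ (ZMod m) := ⟨fun _ _ => rfl⟩
    have hc : Nat.card (TrivSqZeroExt ℤ (ZMod m))ˣ = m + m := by
      rw [TrivSqZeroExt.card_units, Nat.card_zmod, Nat.card_eq_fintype_card,
        Fintype.card_units_int, two_mul]
    refine ⟨TrivSqZeroExt ℤ (ZMod m), inferInstance, ⟨fun a b h => ?_⟩,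
      Nat.finite_of_card_ne_zero (by omega), hc⟩
    simpa using congrArg TrivSqZeroExt.fst h
end

section
/- A positive integer n is the cardinality of the group of units of some commutative ring with identity having finite unit group if and only if n is even, or n is a finite product of integers of the form 2^λ − 1 with λ ≥ 1 (i.e., there is a finite list λ_1, …, λ_m of positive integers with n = ∏_{i=1}^m (2^{λ_i} − 1)). -/
/-- The ring is the trivial square-zero extension of `ℤ` by `ZMod m`. -/
theorem exists_commRing_card_units_eq_two_mul (m : ℕ) [NeZero m] :
    ∃ (A : Type) (_ : CommRing A), Finite Aˣ ∧ Nat.card Aˣ = 2 * m := by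
  let _ : Module ℤᵐᵒᵖ (ZMod m) :=
    Module.compHom (ZMod m) ((RingHom.id ℤ).fromOpposite fun _ _ => Commute.all _ _)
  have : IsCentralScalar ℤ (ZMod m) := ⟨fun _ _ => rfl⟩
  let e : (TrivSqZeroExt ℤ (ZMod m))ˣ ≃ ℤˣ × ZMod m :=
    { toFun := fun u =>
        (Units.map (TrivSqZeroExt.fstHom ℤ ℤ (ZMod m)).toRingHom.toMonoidHom u, u.val.snd)
      invFun := fun p => (TrivSqZeroExt.isUnit_iff_isUnit_fst
        (x := (TrivSqZeroExt.inl (p.1 : ℤ) + TrivSqZeroExt.inr p.2 :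
          TrivSqZeroExt ℤ (ZMod m))).2 (by simp)).unit
      left_inv := fun u => by
        ext <;> simp
      right_inv := fun p => by
        ext <;> simp }
  refine ⟨TrivSqZeroExt ℤ (ZMod m), inferInstance, Finite.of_equiv _ e.symm, ?_⟩
  rw [Nat.card_congr e, Nat.card_prod, Nat.card_zmod]
  simp

theorem exists_commRing_card_units_eq_prod (L : List ℕ) (hL : ∀ l ∈ L, 1 ≤ l) :
    ∃ (A : Type) (_ : CommRing A), Finite Aˣ ∧
      Nat.card Aˣ = (L.map fun l => 2 ^ l - 1).prod := by
  induction L with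
  | nil => exact ⟨PUnit, inferInstance, inferInstance, by simp⟩
  | cons l L ih =>
    obtain ⟨A, _, hfin, hcard⟩ := ih fun k hk => hL k (List.mem_cons_of_mem _ hk)
    have hl : l ≠ 0 := Nat.one_le_iff_ne_zero.1 (hL l List.mem_cons_self)
    refine ⟨GaloisField 2 l × A, inferInstance,
      Finite.of_equiv _ MulEquiv.prodUnits.symm.toEquiv, ?_⟩
    rw [Nat.card_congr MulEquiv.prodUnits.toEquiv, Nat.card_prod, hcard, Nat.card_units,
      GaloisField.card 2 l hl, List.map_cons, List.prod_cons]

theorem card_units_eq_prod_of_finite_isReduced (B : Type*) [CommRing B] [Finite B] [IsReduced B]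
    [CharP B 2] :
    ∃ L : List ℕ, (∀ l ∈ L, 1 ≤ l) ∧ Nat.card Bˣ = (L.map fun l => 2 ^ l - 1).prod := by
  classical
  have : Fintype (MaximalSpectrum B) := Fintype.ofFinite _
  have key (I : MaximalSpectrum B) :
      ∃ l : ℕ, 1 ≤ l ∧ Nat.card (B ⧸ I.asIdeal)ˣ = 2 ^ l - 1 := by
    let _ : Field (B ⧸ I.asIdeal) := Ideal.Quotient.field _
    have : Finite (B ⧸ I.asIdeal) := Finite.of_surjective _ Ideal.Quotient.mk_surjective
    have : Fintype (B ⧸ I.asIdeal) := Fintype.ofFinite _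
    have : CharP (B ⧸ I.asIdeal) 2 := CharTwo.of_one_ne_zero_of_two_eq_zero one_ne_zero <| by
      rw [← map_ofNat (Ideal.Quotient.mk I.asIdeal) 2, CharTwo.two_eq_zero, map_zero]
    obtain ⟨l, -, hl⟩ := FiniteField.card (B ⧸ I.asIdeal) 2
    exact ⟨l, l.2, by rw [Nat.card_units, Nat.card_eq_fintype_card, hl]⟩
  choose f hf hcard using key
  refine ⟨Finset.univ.toList.map f, by simpa using hf, ?_⟩
  rw [Nat.card_congr ((Units.mapEquiv (IsArtinianRing.equivPi B).toMulEquiv).trans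
    MulEquiv.piUnits).toEquiv, Nat.card_pi, List.map_map, Finset.prod_map_toList]
  exact Finset.prod_congr rfl fun I _ => hcard I

theorem card_units_eq_prod_of_odd {A : Type*} [CommRing A] [Finite Aˣ] (h : Odd (Nat.card Aˣ)) :
    ∃ L : List ℕ, (∀ l ∈ L, 1 ≤ l) ∧ Nat.card Aˣ = (L.map fun l => 2 ^ l - 1).prod := by
  rcases subsingleton_or_nontrivial A with _ | _
  · exact ⟨[], by simp, by simp⟩
  have eq_one {u : Aˣ} {k : ℕ} (hu : u ^ 2 ^ k = 1) : u = 1 := by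
    rw [← orderOf_eq_one_iff]
    exact Nat.Coprime.eq_one_of_dvd
      ((h.of_dvd_nat (orderOf_dvd_natCard u)).coprime_two_right.pow_right k)
      (orderOf_dvd_of_pow_eq_one hu)
  have : CharP A 2 := CharTwo.of_one_ne_zero_of_two_eq_zero one_ne_zero <| by
    have := congrArg Units.val (eq_one (u := -1) (k := 1) (by simp))
    rw [Units.val_neg, Units.val_one] at this
    linear_combination -this
  have hred : IsReduced A := ⟨fun x ⟨k, hk⟩ => by
    have h1 : (1 + x) ^ 2 ^ k = 1 := by
      rw [add_pow_char_pow, one_pow, pow_eq_zero_of_le k.lt_two_pow_self.le hk, add_zero]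
    have hu : IsUnit (1 + x) := IsUnit.of_pow_eq_one h1 (by simp)
    have := congrArg Units.val (eq_one (u := hu.unit) (k := k) (Units.ext (by simpa using h1)))
    simpa using this⟩
  let _ : Algebra (ZMod 2) A := ZMod.algebra A 2
  let φ : MonoidAlgebra (ZMod 2) Aˣ →ₐ[ZMod 2] A := MonoidAlgebra.lift _ _ _ (Units.coeHom A)
  have : Finite (MonoidAlgebra (ZMod 2) Aˣ) := Module.finite_of_finite (ZMod 2)
  have : Finite φ.range := Set.finite_range φ
  have hmem (u : Aˣ) : (u : A) ∈ φ.range := ⟨MonoidAlgebra.of _ _ u, by simp [φ]⟩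
  have : IsReduced φ.range := isReduced_of_injective φ.range.val Subtype.val_injective
  have : CharP φ.range 2 :=
    charP_of_injective_algebraMap (algebraMap (ZMod 2) φ.range).injective 2
  let e : Aˣ ≃ φ.rangeˣ :=
    { toFun := fun u => ⟨⟨u, hmem u⟩, ⟨(u⁻¹ : Aˣ), hmem _⟩, by ext; simp, by ext; simp⟩
      invFun := Units.map φ.range.val.toMonoidHom
      left_inv := fun u => by ext; simp
      right_inv := fun u => by ext; simp }
  rw [Nat.card_congr e]
  exact card_units_eq_prod_of_finite_isReduced φ.range

/-- A positive integer `n` is the cardinality of the unit group of some commutative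
ring with finite unit group if and only if `n` is even, or `n` is a finite product of
integers of the form `2 ^ λ - 1` with `λ ≥ 1`. -/
theorem stmt_15 (n : ℕ) (hn : 0 < n) :
    (∃ (A : Type) (_ : CommRing A), Finite Aˣ ∧ Nat.card Aˣ = n) ↔
    (Even n ∨ ∃ L : List ℕ, (∀ l ∈ L, 1 ≤ l) ∧
        n = (L.map fun l => 2 ^ l - 1).prod) := by
  constructor
  · rintro ⟨A, _, _, rfl⟩
    exact (Nat.even_or_odd _).imp_right card_units_eq_prod_of_odd
  · rintro (⟨m, rfl⟩ | ⟨L, hL, rfl⟩)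
    · have : NeZero m := ⟨by omega⟩
      rw [← two_mul]
      exact exists_commRing_card_units_eq_two_mul m
    · exact exists_commRing_card_units_eq_prod L hL
end

section
/- Let A be a commutative ring with identity whose group of units A* is finite of prime cardinality p. Then p = 2 or p = 2^λ − 1 for some integer λ ≥ 2 (i.e., p is a Mersenne prime). -/
/-- Some positive power of every element of a finite monoid is idempotent. -/
theorem exists_pos_isIdempotentElem_pow {M : Type*} [Monoid M] [Finite M] (b : M) :
    ∃ n, 0 < n ∧ IsIdempotentElem (b ^ n) := by
  obtain ⟨i, j, hij, h⟩ : ∃ i j : ℕ, i < j ∧ b ^ i = b ^ j := by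
    obtain ⟨i, j, hne, h⟩ := Finite.exists_ne_map_eq_of_infinite (fun n : ℕ => b ^ n)
    rcases lt_or_gt_of_ne hne with hlt | hlt
    · exact ⟨i, j, hlt, h⟩
    · exact ⟨j, i, hlt, h.symm⟩
  obtain ⟨d, rfl⟩ := Nat.exists_eq_add_of_lt hij
  have period (k m : ℕ) (hm : i ≤ m) : b ^ (m + k * (d + 1)) = b ^ m := by
    induction k with
    | zero => simp
    | succ k ih =>
      obtain ⟨c, rfl⟩ := Nat.exists_eq_add_of_le hm
      calc b ^ (i + c + (k + 1) * (d + 1)) = b ^ (i + d + 1) * b ^ (c + k * (d + 1)) := by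
            rw [← pow_add]; congr 1; ring
        _ = b ^ (i + c + k * (d + 1)) := by rw [← h, ← pow_add]; congr 1; ring
        _ = b ^ (i + c) := ih
  refine ⟨(i + 1) * (d + 1), by positivity, ?_⟩
  rw [IsIdempotentElem, ← pow_add]
  exact period _ _ (by nlinarith)

/-- Units lift along surjections from a finite commutative ring to a domain. -/
theorem units_map_surjective_of_finite {B K : Type*} [CommRing B] [Finite B] [CommRing K]
    [IsDomain K] (f : B →+* K) (hf : Function.Surjective f) :
    Function.Surjective (Units.map (f : B →* K)) := by
  intro x
  obtain ⟨b, hb⟩ := hf x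
  obtain ⟨n, hn, he⟩ := exists_pos_isIdempotentElem_pow b
  obtain ⟨m, rfl⟩ := Nat.exists_eq_add_of_lt hn
  rw [IsIdempotentElem] at he
  have hfe : f (b ^ (0 + m + 1)) = 1 := by
    have hne : f (b ^ (0 + m + 1)) ≠ 0 := by
      rw [map_pow, hb]
      exact pow_ne_zero _ x.ne_zero
    apply mul_left_cancel₀ hne
    rw [← map_mul, he, mul_one]
  have hpow : b * b ^ m = b ^ (0 + m + 1) := by ring
  generalize b ^ (0 + m + 1) = e at *
  have hunit : (b * e + (1 - e)) * (b ^ m * e + (1 - e)) = 1 := by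
    linear_combination (e * e) * hpow + (e + 2 - b - b ^ m) * he
  refine ⟨Units.mkOfMulEqOne _ _ hunit, Units.ext ?_⟩
  change f (b * e + (1 - e)) = x
  simp [hfe, hb]

/-- In characteristic two, a unit `u` of odd order with `u - 1` nilpotent is trivial. -/
theorem eq_one_of_isNilpotent_sub_one {B : Type*} [CommRing B] [CharP B 2] {u : B} {p : ℕ}
    (hp : Odd p) (hu : u ^ p = 1) (h : IsNilpotent (u - 1)) : u = 1 := by
  obtain ⟨n, hn⟩ := h
  have h0 : (u - 1) ^ 2 ^ n = 0 := pow_eq_zero_of_le n.lt_two_pow_self.le hn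
  have : ExpChar B 2 := ExpChar.prime Nat.prime_two
  rw [sub_pow_expChar_pow, one_pow, sub_eq_zero] at h0
  have hco : Nat.Coprime (2 ^ n) p := (Nat.coprime_two_left.mpr hp).pow_left n
  have := Nat.dvd_gcd (orderOf_dvd_of_pow_eq_one h0) (orderOf_dvd_of_pow_eq_one hu)
  rw [hco] at this
  exact orderOf_eq_one_iff.mp (Nat.dvd_one.mp this)

/-- If the unit group of a commutative ring is finite of prime cardinality `p`, then
`p = 2` or `p` is a Mersenne prime. -/
theorem stmt_16 (A : Type*) [CommRing A] [Finite Aˣ] (p : ℕ) (hp : p.Prime)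
    (hcard : Nat.card Aˣ = p) :
    p = 2 ∨ ∃ l : ℕ, 2 ≤ l ∧ p = 2 ^ l - 1 := by
  refine or_iff_not_imp_left.mpr fun hp2 => ?_
  have hodd : Odd p := hp.odd_of_ne_two hp2
  have hpow (v : Aˣ) : v ^ p = 1 := hcard ▸ pow_card_eq_one'
  have : Nontrivial Aˣ := Finite.one_lt_card_iff_nontrivial.mp (hcard ▸ hp.one_lt)
  obtain ⟨u, hu⟩ := exists_ne (1 : Aˣ)
  have : Nontrivial A := ⟨u, 1, fun h => hu (Units.ext h)⟩
  have hneg : (-1 : A) = 1 := by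
    have := congrArg Units.val (hpow (-1))
    simpa [hodd.neg_one_pow] using this
  have : CharP A 2 := CharTwo.of_one_ne_zero_of_two_eq_zero one_ne_zero (by
    linear_combination -hneg)
  let : Algebra (ZMod 2) A := ZMod.algebra A 2
  have hup : (u : A) ^ p = 1 := by rw [← Units.val_pow_eq_pow_val, hpow, Units.val_one]
  have hint : IsIntegral (ZMod 2) (u : A) :=
    IsIntegral.of_pow hp.pos (hup ▸ isIntegral_one)
  let B := Algebra.adjoin (ZMod 2) {(u : A)}
  have : Module.Finite (ZMod 2) B := Module.Finite.iff_fg.mpr hint.fg_adjoin_singleton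
  have : Finite B := Module.finite_of_finite (ZMod 2)
  have : CharP B 2 := charP_of_injective_algebraMap' (ZMod 2) 2
  let w : B := ⟨u, Algebra.self_mem_adjoin_singleton _ _⟩
  have hwp : w ^ p = 1 := Subtype.ext hup
  have hw1 : w ≠ 1 := fun h => hu (Units.ext (congrArg Subtype.val h))
  obtain ⟨P, hP, hwP⟩ : ∃ P : Ideal B, P.IsPrime ∧ w - 1 ∉ P := by
    by_contra! h
    exact hw1 (eq_one_of_isNilpotent_sub_one hodd hwp (nilpotent_iff_mem_prime.mpr h))
  let K := B ⧸ P
  have : Finite K := Finite.of_surjective _ (Ideal.Quotient.mk_surjective (I := P))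
  let : Field K := (Finite.isField_of_domain K).toField
  let : Fintype K := Fintype.ofFinite K
  have : CharP K 2 := CharTwo.of_one_ne_zero_of_two_eq_zero one_ne_zero (by
    have := congrArg (Ideal.Quotient.mk P) (CharTwo.two_eq_zero (R := B))
    rwa [map_ofNat, map_zero] at this)
  have hKB : Nat.card Kˣ ∣ Nat.card Bˣ := Subgroup.card_dvd_of_surjective _
    (units_map_surjective_of_finite (Ideal.Quotient.mk P) Ideal.Quotient.mk_surjective)
  have hBA : Nat.card Bˣ ∣ Nat.card Aˣ := Subgroup.card_dvd_of_injective
    (Units.map (B.val : B →* A)) (Units.map_injective Subtype.val_injective)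
  have hne : Nat.card Kˣ ≠ 1 := by
    intro h
    have hz : Ideal.Quotient.mk P w ^ p = 1 := by rw [← map_pow, hwp, map_one]
    have := (Nat.card_eq_one_iff_unique.mp h).1
    have h1 := congrArg Units.val
      (Subsingleton.elim (Units.ofPowEqOne (Ideal.Quotient.mk P w) p hz hp.ne_zero) 1)
    apply hwP
    rw [← Ideal.Quotient.eq_zero_iff_mem, map_sub, map_one, sub_eq_zero]
    exact h1
  have hKp : Nat.card Kˣ = p :=
    (hp.eq_one_or_self_of_dvd _ (hcard ▸ hKB.trans hBA)).resolve_left hne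
  obtain ⟨l, -, hl⟩ := FiniteField.card K 2
  have hpl : p = 2 ^ (l : ℕ) - 1 := by
    rw [← hKp, Nat.card_units, Nat.card_eq_fintype_card, hl]
  refine ⟨l, ?_, hpl⟩
  by_contra! hlt
  have : (l : ℕ) = 1 := by have := l.pos; omega
  rw [this] at hpl
  exact hp.ne_one hpl
end

section
/- Let H be a finite abelian group such that: (a) for every prime p ≡ 3 (mod 4), the p-Sylow subgroup of H is isomorphic to K × K for some finite abelian p-group K; and (b) the 2-Sylow subgroup of H is isomorphic to P or to ℤ/4ℤ × P, where P = ℤ/2^{e_1}ℤ × ⋯ × ℤ/2^{e_{2r}}ℤ for some r ≥ 0 and integers 2 ≤ e_1 ≤ e_2 ≤ ⋯ ≤ e_{2r} satisfying e_{2j} − e_{2j−1} ≤ 1 for all j = 1, …, r (P is trivial when r = 0). Then there exists a commutative ring A with identity of characteristic 0 such that A* ≅ ℤ/4ℤ × H. -/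
/-- The units of a trivial square-zero extension split as units of the base times the module. -/
theorem TrivSqZeroExt.nonempty_units_mulEquiv (R M : Type*) [CommRing R] [AddCommGroup M]
    [Module R M] [Module Rᵐᵒᵖ M] [IsCentralScalar R M] :
    Nonempty ((TrivSqZeroExt R M)ˣ ≃* Rˣ × Multiplicative M) := by
  let f : Multiplicative M →* (TrivSqZeroExt R M)ˣ :=
    { toFun := fun m =>
        ⟨1 + inr m.toAdd, 1 - inr m.toAdd, by ext <;> simp, by ext <;> simp⟩
      map_one' := by ext <;> simp
      map_mul' := fun a b => by ext <;> simp [add_comm] }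
  let g : Rˣ →* (TrivSqZeroExt R M)ˣ := Units.map (inlHom R M).toMonoidHom
  have hfst (v : Rˣ) (m : Multiplicative M) : (g v * f m : TrivSqZeroExt R M).fst = v := by
    simp [f, g]
  have hsnd (v : Rˣ) (m : Multiplicative M) :
      (g v * f m : TrivSqZeroExt R M).snd = (v : R) • m.toAdd := by
    simp [f, g]
  refine ⟨(MulEquiv.ofBijective (g.coprod f) ⟨?_, ?_⟩).symm⟩
  · rintro ⟨v, m⟩ ⟨w, n⟩ h
    have h' : (g v * f m : TrivSqZeroExt R M) = g w * f n := congrArg Units.val h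
    have hvw : v = w := Units.ext (by rw [← hfst v m, h', hfst])
    subst hvw
    have hmn : (v : R) • m.toAdd = (v : R) • n.toAdd := by rw [← hsnd, h', hsnd]
    have hmn' : m.toAdd = n.toAdd := MulAction.injective v hmn
    rw [Multiplicative.toAdd.injective hmn']
  · intro u
    let v : Rˣ := Units.map (fstHom R R M : TrivSqZeroExt R M →* R) u
    refine ⟨(v, .ofAdd ((v⁻¹ : Rˣ) • (u : TrivSqZeroExt R M).snd)), Units.ext ?_⟩
    ext
    · exact hfst _ _
    · refine (hsnd _ _).trans ?_
      exact smul_inv_smul v _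

theorem GaussianInt.nonempty_units_mulEquiv : Nonempty (GaussianIntˣ ≃* Multiplicative (ZMod 4)) := by
  let i : GaussianIntˣ := ⟨⟨0, 1⟩, ⟨0, -1⟩, by decide, by decide⟩
  have hi (x : GaussianIntˣ) : x ∈ Subgroup.zpowers i := by
    have hx := (Zsqrtd.norm_eq_one_iff' (by norm_num) (x : GaussianInt)).2 x.isUnit
    rw [Zsqrtd.norm_def] at hx
    have h1 : (x : GaussianInt).re ≤ 1 := by nlinarith [mul_self_nonneg (x : GaussianInt).im]
    have h2 : -1 ≤ (x : GaussianInt).re := by nlinarith [mul_self_nonneg (x : GaussianInt).im]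
    have h3 : (x : GaussianInt).im ≤ 1 := by nlinarith
    have h4 : -1 ≤ (x : GaussianInt).im := by nlinarith
    have key (n : ℕ) (h : ((i ^ n : GaussianIntˣ) : GaussianInt) = x) : x ∈ Subgroup.zpowers i :=
      ⟨n, (zpow_natCast i n).trans (Units.ext h)⟩
    generalize (x : GaussianInt) = z at hx h1 h2 h3 h4 key
    obtain ⟨a, b⟩ := z
    dsimp only at hx h1 h2 h3 h4
    interval_cases a <;> interval_cases b <;> first
      | omega
      | exact key 0 (by decide)
      | exact key 1 (by decide)
      | exact key 2 (by decide)
      | exact key 3 (by decide)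
  have hcyc : IsCyclic GaussianIntˣ := ⟨i, hi⟩
  have hord : orderOf i = 2 ^ 2 :=
    orderOf_eq_prime_pow (p := 2) (n := 1) (by decide) (by decide)
  refine ⟨mulEquivOfCyclicCardEq ?_⟩
  rw [← orderOf_eq_card_of_forall_mem_zpowers hi, hord]
  simp

/-- An abelian group has an *imaginary unit* if it admits an endomorphism whose square is
inversion, that is, if it underlies a module over the Gaussian integers. -/
def HasImaginaryUnit (G : Type*) [CommGroup G] : Prop :=
  ∃ J : G →* G, ∀ x, J (J x) = x⁻¹

namespace HasImaginaryUnit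

theorem of_mulEquiv {G G' : Type*} [CommGroup G] [CommGroup G'] (h : HasImaginaryUnit G)
    (e : G' ≃* G) : HasImaginaryUnit G' := by
  obtain ⟨J, hJ⟩ := h
  exact ⟨(e.symm.toMonoidHom.comp J).comp e.toMonoidHom, fun x => by simp [hJ]⟩

theorem pi {ι : Type*} {G : ι → Type*} [∀ i, CommGroup (G i)] (h : ∀ i, HasImaginaryUnit (G i)) :
    HasImaginaryUnit (∀ i, G i) := by
  choose J hJ using h
  exact ⟨MonoidHom.mk' (fun x i => J i (x i)) (fun x y => by ext; simp),
    fun x => by ext i; simp [hJ]⟩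

theorem prod_self (K : Type*) [CommGroup K] : HasImaginaryUnit (K × K) :=
  ⟨MonoidHom.mk' (fun x => (x.2⁻¹, x.1)) (fun x y => by ext <;> simp [mul_comm]),
    fun x => by ext <;> simp⟩

theorem of_pow_eq_one {G : Type*} [CommGroup G] {n u : ℕ} (hn : ∀ x : G, x ^ n = 1)
    (hu : n ∣ u ^ 2 + 1) : HasImaginaryUnit G := by
  refine ⟨powMonoidHom u, fun x => eq_inv_of_mul_eq_one_left ?_⟩
  obtain ⟨k, hk⟩ := hu
  simp only [powMonoidHom_apply]
  rw [← pow_mul, ← pow_succ, ← sq, hk, pow_mul, hn, one_pow]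

/-- The endomorphism `(x, y) ↦ (x + y, -2x - y)` squares to `-1`. -/
theorem zmod_two_pow_succ (e : ℕ) :
    HasImaginaryUnit (Multiplicative (ZMod (2 ^ e)) × Multiplicative (ZMod (2 ^ (e + 1)))) := by
  let r : ZMod (2 ^ (e + 1)) →+* ZMod (2 ^ e) := ZMod.castHom (pow_dvd_pow 2 e.le_succ) _
  obtain ⟨d, hd⟩ : ∃ d : ZMod (2 ^ e) →+ ZMod (2 ^ (e + 1)), ∀ z : ℤ, d z = 2 * z := by
    refine ⟨ZMod.lift _ ⟨(AddMonoidHom.mulLeft 2).comp (Int.castAddHom _), ?_⟩, fun z => ?_⟩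
    · have : ((2 ^ (e + 1) : ℕ) : ZMod (2 ^ (e + 1))) = 0 := ZMod.natCast_self _
      push_cast at this ⊢
      simpa [pow_succ, mul_comm] using this
    · simp
  let J : ZMod (2 ^ e) × ZMod (2 ^ (e + 1)) →+ ZMod (2 ^ e) × ZMod (2 ^ (e + 1)) :=
    AddMonoidHom.mk' (fun x => (x.1 + r x.2, -d x.1 - x.2)) fun x y => by
      ext <;> simp <;> ring
  have hJ (x) : J (J x) = -x := by
    obtain ⟨a, b⟩ := x
    obtain ⟨a, rfl⟩ := ZMod.intCast_surjective a
    obtain ⟨b, rfl⟩ := ZMod.intCast_surjective b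
    ext
    · have h2 : r 2 = 2 := map_ofNat r 2
      simp [J, hd, h2]; ring
    · have := hd (a + b)
      push_cast at this
      simp [J, hd]; ring
  refine of_mulEquiv (G := Multiplicative (ZMod (2 ^ e) × ZMod (2 ^ (e + 1))))
    ⟨AddMonoidHom.toMultiplicative J, fun x => ?_⟩ (MulEquiv.prodMultiplicative _ _).symm
  exact congrArg Multiplicative.ofAdd (hJ x.toAdd)

end HasImaginaryUnit

theorem exists_pow_dvd_sq_add_one {p : ℕ} (hp : p.Prime) (h : p % 4 = 1) (k : ℕ) :
    ∃ u : ℕ, p ^ k ∣ u ^ 2 + 1 := by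
  have := Fact.mk hp
  obtain ⟨y, hy⟩ := ZMod.exists_sq_eq_neg_one_iff (p := p) |>.2 (by omega)
  have hodd : Odd p := Nat.odd_iff.2 (by omega)
  have hdvd : (p : ℤ) ∣ (y.val : ℤ) ^ 2 - (-1) := by
    rw [← ZMod.intCast_zmod_eq_zero_iff_dvd]
    push_cast
    rw [ZMod.natCast_zmod_val, sq, ← hy]; ring
  refine ⟨y.val ^ p ^ k, (pow_dvd_pow p k.le_succ).trans ?_⟩
  have := dvd_sub_pow_of_dvd_sub hdvd k
  rw [(hodd.pow).neg_one_pow, sub_neg_eq_add, ← pow_mul, mul_comm, pow_mul] at this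
  exact_mod_cast this

/-- A group that is a product of the units of a ring and a group with an imaginary unit. -/
def IsUnitsProdImaginary (G : Type) [CommGroup G] : Prop :=
  ∃ (R : Type) (_ : CommRing R) (M : Type) (_ : CommGroup M),
    HasImaginaryUnit M ∧ Nonempty (G ≃* Rˣ × M)

theorem HasImaginaryUnit.isUnitsProdImaginary {G : Type} [CommGroup G] (h : HasImaginaryUnit G) :
    IsUnitsProdImaginary G :=
  ⟨PUnit, inferInstance, G, inferInstance, h, ⟨MulEquiv.uniqueProd.symm⟩⟩

namespace IsUnitsProdImaginary

theorem of_mulEquiv {G G' : Type} [CommGroup G] [CommGroup G'] (h : IsUnitsProdImaginary G)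
    (e : G' ≃* G) : IsUnitsProdImaginary G' := by
  obtain ⟨R, _, M, _, hM, ⟨f⟩⟩ := h
  exact ⟨R, _, M, _, hM, ⟨e.trans f⟩⟩

theorem pi {ι : Type} {G : ι → Type} [∀ i, CommGroup (G i)]
    (h : ∀ i, IsUnitsProdImaginary (G i)) : IsUnitsProdImaginary (∀ i, G i) := by
  choose R _ M _ hM f using h
  refine ⟨∀ i, R i, inferInstance, ∀ i, M i, inferInstance, .pi hM, ⟨?_⟩⟩
  refine (MulEquiv.piCongrRight fun i => (f i).some).trans ?_
  refine MulEquiv.trans ?_ (MulEquiv.piUnits.symm.prodCongr (MulEquiv.refl _))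
  exact { toFun := fun x => (fun i => (x i).1, fun i => (x i).2)
          invFun := fun x i => (x.1 i, x.2 i)
          left_inv := fun _ => rfl
          right_inv := fun _ => rfl
          map_mul' := fun _ _ => rfl }

theorem exists_charZero_units {G : Type} [CommGroup G] (h : IsUnitsProdImaginary G) :
    ∃ (A : Type) (_ : CommRing A), CharZero A ∧
      Nonempty (Aˣ ≃* Multiplicative (ZMod 4) × G) := by
  obtain ⟨R, _, M, _, ⟨J, hJ⟩, ⟨f⟩⟩ := h
  let j : Additive M →+ Additive M := MonoidHom.toAdditive J
  have hj (x : Additive M) : j (j x) = -x := hJ x.toMul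
  let _ : Module GaussianInt (Additive M) :=
    { smul := fun z x => z.re • x + z.im • j x
      one_smul := fun x => by
        change (1 : ℤ) • x + (0 : ℤ) • j x = x
        simp
      mul_smul := fun z w x => by
        change (z * w).re • x + (z * w).im • j x =
          z.re • (w.re • x + w.im • j x) + z.im • j (w.re • x + w.im • j x)
        simp only [Zsqrtd.re_mul, Zsqrtd.im_mul, map_add, map_zsmul, hj]
        module
      smul_zero := fun z => by
        change z.re • (0 : Additive M) + z.im • j 0 = 0
        simp
      zero_smul := fun x => by
        change (0 : ℤ) • x + (0 : ℤ) • j x = 0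
        simp
      smul_add := fun z x y => by
        change z.re • (x + y) + z.im • j (x + y) = z.re • x + z.im • j x + (z.re • y + z.im • j y)
        simp only [map_add]
        module
      add_smul := fun z w x => by
        change (z.re + w.re) • x + (z.im + w.im) • j x =
          z.re • x + z.im • j x + (w.re • x + w.im • j x)
        module }
  let _ : Module GaussianIntᵐᵒᵖ (Additive M) :=
    Module.compHom _ ((RingHom.id GaussianInt).fromOpposite mul_comm)
  have : IsCentralScalar GaussianInt (Additive M) := ⟨fun _ _ => rfl⟩
  obtain ⟨g⟩ := TrivSqZeroExt.nonempty_units_mulEquiv GaussianInt (Additive M)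
  obtain ⟨k⟩ := GaussianInt.nonempty_units_mulEquiv
  refine ⟨R × TrivSqZeroExt GaussianInt (Additive M), inferInstance, ⟨fun m n hmn => ?_⟩, ⟨?_⟩⟩
  · have := congrArg (fun x => x.2.fst) hmn
    simpa using this
  · have e₁ : (TrivSqZeroExt GaussianInt (Additive M))ˣ ≃* Multiplicative (ZMod 4) × M :=
      g.trans (k.prodCongr (MulEquiv.refl M : Multiplicative (Additive M) ≃* M))
    refine MulEquiv.prodUnits.trans ?_
    refine ((MulEquiv.refl _).prodCongr e₁).trans ?_
    refine MulEquiv.trans ?_ ((MulEquiv.refl _).prodCongr f.symm)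
    exact { toFun := fun x => (x.2.1, (x.1, x.2.2))
            invFun := fun x => (x.2.1, (x.1, x.2.2))
            left_inv := fun _ => rfl
            right_inv := fun _ => rfl
            map_mul' := fun _ _ => rfl }

end IsUnitsProdImaginary

/-- A product over `Fin (2 * r)` is the product of its consecutive pairs of factors. -/
def MulEquiv.piFinTwoMul {r : ℕ} (G : Fin (2 * r) → Type*) [∀ i, CommGroup (G i)] :
    (∀ i, G i) ≃* ∀ j : Fin r, G ⟨2 * j, by omega⟩ × G ⟨2 * j + 1, by omega⟩ where
  toFun x j := (x _, x _)
  invFun y i :=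
    if h : (i : ℕ) % 2 = 0 then
      cast (congrArg G (Fin.ext (by simp; omega))) (y ⟨i / 2, by omega⟩).1
    else cast (congrArg G (Fin.ext (by simp; omega))) (y ⟨i / 2, by omega⟩).2
  left_inv x := by
    have key (i k : Fin (2 * r)) (h : i = k) (h' : G i = G k) : cast h' (x i) = x k := by
      subst h; rfl
    funext i
    dsimp only
    split_ifs with h
    · exact key _ _ (Fin.ext (by simp; omega)) _
    · exact key _ _ (Fin.ext (by simp; omega)) _
  right_inv y := by
    have key₁ (j k : Fin r) (h : j = k) (h') : cast h' (y j).1 = (y k).1 := by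
      subst h; rfl
    have key₂ (j k : Fin r) (h : j = k) (h') : cast h' (y j).2 = (y k).2 := by
      subst h; rfl
    funext j
    refine Prod.ext ?_ ?_
    · dsimp only
      rw [dif_pos (by omega)]
      exact key₁ _ _ (Fin.ext (by simp)) _
    · dsimp only
      rw [dif_neg (by omega)]
      exact key₂ _ _ (Fin.ext (by simp; omega)) _
  map_mul' _ _ := rfl

theorem HasImaginaryUnit.pi_zmod_two_pow {r : ℕ} (e : Fin (2 * r) → ℕ) (hmono : Monotone e)
    (he : ∀ j : Fin r, e ⟨2 * j + 1, by omega⟩ - e ⟨2 * j, by omega⟩ ≤ 1) :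
    HasImaginaryUnit (∀ i, Multiplicative (ZMod (2 ^ e i))) := by
  refine of_mulEquiv (pi fun j => ?_) (MulEquiv.piFinTwoMul _)
  have hle : e ⟨2 * j, by omega⟩ ≤ e ⟨2 * j + 1, by omega⟩ := hmono (by simp)
  have hsub := he j
  obtain h | h : e ⟨2 * j + 1, by omega⟩ = e ⟨2 * j, by omega⟩ ∨
      e ⟨2 * j + 1, by omega⟩ = e ⟨2 * j, by omega⟩ + 1 := by omega
  · rw [h]
    exact prod_self _
  · rw [h]
    exact zmod_two_pow_succ _

/-- Let `H` be a finite abelian group such that (a) for every prime `p ≡ 3 (mod 4)`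
the `p`-Sylow subgroup of `H` is the square of a group, and (b) the `2`-Sylow subgroup
of `H` is isomorphic to `P` or to `ℤ/4ℤ × P`, where
`P = ℤ/2^{e_1}ℤ × ⋯ × ℤ/2^{e_{2r}}ℤ` with `2 ≤ e_1 ≤ ⋯ ≤ e_{2r}` and
`e_{2j} - e_{2j-1} ≤ 1` for all `j`. Then `ℤ/4ℤ × H` is the unit group of some
commutative ring of characteristic 0. -/
theorem stmt_17 (H : Type) [CommGroup H] [Finite H]
    (ha : ∀ p : ℕ, p.Prime → p % 4 = 3 → ∀ P : Sylow p H,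
      ∃ (K : Type) (_ : CommGroup K), Finite K ∧
        Nonempty (↥(P : Subgroup H) ≃* K × K))
    (hb : ∀ Q : Sylow 2 H,
      ∃ (r : ℕ) (e : Fin (2 * r) → ℕ),
        (∀ i, 2 ≤ e i) ∧ Monotone e ∧
        (∀ (j : ℕ) (h : 2 * j + 1 < 2 * r),
          e ⟨2 * j + 1, h⟩ - e ⟨2 * j, by omega⟩ ≤ 1) ∧
        (Nonempty (↥(Q : Subgroup H) ≃*
            ((i : Fin (2 * r)) → Multiplicative (ZMod (2 ^ e i)))) ∨
         Nonempty (↥(Q : Subgroup H) ≃* Multiplicative (ZMod 4) ×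
            ((i : Fin (2 * r)) → Multiplicative (ZMod (2 ^ e i)))))) :
    ∃ (A : Type) (_ : CommRing A), CharZero A ∧
      Nonempty (Aˣ ≃* Multiplicative (ZMod 4) × H) := by
  have hcomm {p : ℕ} [Fact p.Prime] (P : Sylow p H) : (P : Subgroup H).Normal := inferInstance
  refine IsUnitsProdImaginary.exists_charZero_units
    (.of_mulEquiv (.pi fun p => .pi fun P => ?_) (Sylow.directProductOfNormal hcomm).symm)
  obtain ⟨p, hp⟩ := p
  have hpp := Nat.prime_of_mem_primeFactors hp
  obtain rfl | h | h : p = 2 ∨ p % 4 = 1 ∨ p % 4 = 3 := by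
    obtain h | h := hpp.eq_two_or_odd <;> omega
  · obtain ⟨r, e, -, hmono, he', hP⟩ := hb P
    have he (j : Fin r) := he' j (by omega)
    obtain ⟨⟨f⟩⟩ | ⟨⟨f⟩⟩ := hP
    · exact ((HasImaginaryUnit.pi_zmod_two_pow e hmono he).of_mulEquiv f).isUnitsProdImaginary
    · obtain ⟨k⟩ := GaussianInt.nonempty_units_mulEquiv
      exact ⟨GaussianInt, inferInstance, _, inferInstance, .pi_zmod_two_pow e hmono he,
        ⟨f.trans (k.symm.prodCongr (MulEquiv.refl _))⟩⟩
  · have := Fact.mk hpp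
    obtain ⟨k, hk⟩ := IsPGroup.iff_card.1 P.isPGroup'
    obtain ⟨u, hu⟩ := exists_pow_dvd_sq_add_one hpp h k
    exact (HasImaginaryUnit.of_pow_eq_one (fun x => hk ▸ pow_card_eq_one') hu).isUnitsProdImaginary
  · obtain ⟨K, _, -, ⟨f⟩⟩ := ha p hpp h P
    exact ((HasImaginaryUnit.prod_self K).of_mulEquiv f).isUnitsProdImaginary
end

section
/- Let A be a commutative ring with identity whose group of units A* is finite, such that every additive torsion element of A is nilpotent, and suppose that −1 = α² for some α ∈ A* (this holds in particular when ε(A) = 2). Then the group of units of the quotient ring A/N, where N is the nilradical of A, contains no element of order 3. -/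
/-- If `i ^ 2 = -1` and `u ^ 3 = 1`, then `1 - t - r`, with `r = i * (u - u ^ 2)` and
`t = 2 - u - u ^ 2`, is a unit with inverse `1 - t + r`. -/
theorem mul_eq_one_of_sq_eq_neg_one_of_cube_eq_one {B : Type*} [CommRing B] {i u : B}
    (hi : i ^ 2 = -1) (hu : u ^ 3 = 1) :
    (1 - (2 - u - u ^ 2) - i * (u - u ^ 2)) * (1 - (2 - u - u ^ 2) + i * (u - u ^ 2)) = 1 := by
  grind

/-- The powers of `(1 - t - r) ^ 2` act on `t` like the powers of `7 + 4 √3`. -/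
theorem exists_pow_mul_eq {B : Type*} [CommRing B] {t r : B}
    (ht : t ^ 2 = 3 * t) (hr : r ^ 2 = t) (htr : t * r = 3 * r) (n : ℕ) :
    ∃ a b : ℕ, n + 1 ≤ a ∧ 3 * a ^ 2 = b ^ 2 + 3 ∧
      ((1 - t - r) ^ 2) ^ n * t = a * t + b * r := by
  induction n with
  | zero => exact ⟨1, 0, by simp⟩
  | succ n ih =>
    obtain ⟨a, b, ha, hab, h⟩ := ih
    refine ⟨7 * a + 4 * b, 12 * a + 7 * b, by omega, by nlinarith, ?_⟩
    have hw : (1 - t - r) ^ 2 = 1 + 2 * t + 4 * r := by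
      linear_combination ht + hr + 2 * htr
    rw [pow_succ, mul_right_comm, h, hw]
    push_cast
    linear_combination (2 * a : B) * ht + (4 * a + 2 * b : B) * htr + (4 * b : B) * hr

/-- If `B` has no additive torsion and `1 - t - r` has finite order, then `t = 0`. -/
theorem eq_zero_of_pow_eq_one {B : Type*} [CommRing B]
    (hB : ∀ (n : ℕ) (x : B), 0 < n → n • x = 0 → x = 0) {t r : B}
    (ht : t ^ 2 = 3 * t) (hr : r ^ 2 = t) (htr : t * r = 3 * r) {n : ℕ} (hn : 0 < n)
    (h : (1 - t - r) ^ n = 1) : t = 0 := by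
  obtain ⟨a, b, ha, hab, hp⟩ := exists_pow_mul_eq ht hr htr n
  rw [pow_right_comm, h, one_pow, one_mul] at hp
  obtain ⟨c, rfl⟩ : ∃ c, a = c + 1 := ⟨a - 1, by omega⟩
  refine hB (6 * c) t (by omega) ?_
  have hab' : (3 * (c + 1) ^ 2 : B) = b ^ 2 + 3 := by
    exact_mod_cast congrArg (Nat.cast (R := B)) hab
  push_cast at hp
  rw [nsmul_eq_mul]
  push_cast
  linear_combination (c * t - b * r) * hp + t * hab' + (c : B) ^ 2 * ht - (b : B) ^ 2 * hr

theorem nilradical_quotient_eq_zero_of_nsmul_eq_zero {A : Type*} [CommRing A]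
    (htors : ∀ x : A, (∃ n : ℕ, 0 < n ∧ n • x = 0) → IsNilpotent x)
    (n : ℕ) (x : A ⧸ nilradical A) (hn : 0 < n) (h : n • x = 0) : x = 0 := by
  obtain ⟨x, rfl⟩ := Ideal.Quotient.mk_surjective x
  rw [← map_nsmul, Ideal.Quotient.eq_zero_iff_mem, mem_nilradical] at h
  rw [Ideal.Quotient.eq_zero_iff_mem, mem_nilradical]
  obtain ⟨k, hk⟩ := h
  obtain ⟨m, hm⟩ := htors (x ^ k) ⟨n ^ k, pow_pos hn k, by rwa [← smul_pow]⟩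
  exact ⟨k * m, by rwa [pow_mul]⟩

theorem exists_pow_eq_one_of_isUnit_quotient_nilradical {A : Type*} [CommRing A] [Finite Aˣ]
    {x : A ⧸ nilradical A} (hx : IsUnit x) : ∃ n : ℕ, 0 < n ∧ x ^ n = 1 := by
  obtain ⟨x, rfl⟩ := Ideal.Quotient.mk_surjective x
  have hxA : IsUnit x := by
    obtain ⟨y, hy⟩ := hx.exists_right_inv
    obtain ⟨y, rfl⟩ := Ideal.Quotient.mk_surjective y
    rw [← map_mul, ← map_one (Ideal.Quotient.mk (nilradical A)), Ideal.Quotient.eq,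
      mem_nilradical] at hy
    have := hy.isUnit_add_one
    rw [sub_add_cancel] at this
    exact isUnit_of_mul_isUnit_left this
  obtain ⟨v, rfl⟩ := hxA
  obtain ⟨n, hn, hv⟩ := (isOfFinOrder_of_finite v).exists_pow_eq_one
  refine ⟨n, hn, ?_⟩
  rw [← map_pow, ← Units.val_pow_eq_pow_val, hv, Units.val_one, map_one]

theorem stmt_18 (A : Type*) [CommRing A] [Finite Aˣ]
    (htors : ∀ x : A, (∃ n : ℕ, 0 < n ∧ n • x = 0) → IsNilpotent x)
    (hsq : ∃ α : Aˣ, α ^ 2 = -1) :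
    ∀ u : (A ⧸ nilradical A)ˣ, orderOf u ≠ 3 := by
  intro u hord
  obtain ⟨α, hα⟩ := hsq
  have hB := nilradical_quotient_eq_zero_of_nsmul_eq_zero htors
  have hu : (u : A ⧸ nilradical A) ^ 3 = 1 := by
    rw [← Units.val_pow_eq_pow_val, ← hord, pow_orderOf_eq_one, Units.val_one]
  have hi : Ideal.Quotient.mk (nilradical A) (α : A) ^ 2 = -1 := by
    rw [← map_pow, ← Units.val_pow_eq_pow_val, hα, Units.val_neg, Units.val_one, map_neg, map_one]
  obtain ⟨n, hn, hv⟩ := exists_pow_eq_one_of_isUnit_quotient_nilradical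
    (IsUnit.of_mul_eq_one _ (mul_eq_one_of_sq_eq_neg_one_of_cube_eq_one hi hu))
  have ht := eq_zero_of_pow_eq_one hB (by grind) (by grind) (by grind) hn hv
  have h1 : (u : A ⧸ nilradical A) - 1 = 0 := by
    refine hB 3 _ three_pos ?_
    rw [nsmul_eq_mul]
    push_cast
    linear_combination hu + (u - 1 : A ⧸ nilradical A) * ht
  have : u = 1 := Units.ext (sub_eq_zero.mp h1)
  simp [this] at hord
end

section
/- Let A be a commutative ring with identity of characteristic 0 whose group of units A* is finite, and suppose −1 = α² for some α ∈ A* (this holds in particular when ε(A) = 2). Let p be a prime with p ≡ 3 (mod 4), and let N_p = {x ∈ N : p^k·x = 0 for some k ≥ 0} be the p-primary component of the nilradical N of A. Then the cardinality of N_p (equivalently, of the multiplicative group 1 + N_p) is a perfect square, i.e., equal to p^{2m} for some natural number m. -/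
/-- If an element `α` of multiplicative order `4` with `α ^ 2 = -1` acts on a finite module `M`
of odd cardinality, then it acts freely on the nonzero elements, so `|M| ≡ 1 (mod 4)`. -/
theorem Module.card_modEq_one_of_sq_eq_neg_one {R M : Type*} [CommRing R] [AddCommGroup M]
    [Module R M] [Finite M] {α : Rˣ} (hα : α ^ 2 = -1) (hord : orderOf α = 4)
    (hodd : Odd (Nat.card M)) : Nat.card M ≡ 1 [MOD 4] := by
  have eq_zero_of_neg_eq {x : M} (h : -x = x) : x = 0 := by
    have h2 : (2 : ℕ) • x = 0 := by rw [two_nsmul, ← sub_neg_eq_add, h, sub_self]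
    have h3 : Nat.card M • x = 0 := card_nsmul_eq_zero'
    have hcop : Nat.Coprime 2 (Nat.card M) := Nat.coprime_two_left.2 hodd
    rw [← AddMonoid.addOrderOf_eq_one_iff]
    exact Nat.eq_one_of_dvd_coprimes hcop (addOrderOf_dvd_of_nsmul_eq_zero h2)
      (addOrderOf_dvd_of_nsmul_eq_zero h3)
  have neg_smul' (x : M) : (-1 : Rˣ) • x = -x := by simp [Units.smul_def]
  have sq_smul (x : M) : α • α • x = -x := by rw [smul_smul, ← sq, hα, neg_smul']
  let S : SubMulAction (Subgroup.zpowers α) M :=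
    { carrier := {x | x ≠ 0}
      smul_mem' := fun c _ hx ↦ (smul_ne_zero_iff_ne c).2 hx }
  have hfree (x : S) : MulAction.stabilizer (Subgroup.zpowers α) x = ⊥ := by
    refine (Subgroup.eq_bot_iff_forall _).2 ?_
    rintro ⟨g, hg⟩ hgx
    have hx : (x : M) ≠ 0 := x.2
    have hgx' : g • (x : M) = x := congrArg Subtype.val hgx
    have hfin : IsOfFinOrder α := orderOf_pos_iff.1 (by omega)
    classical
    rw [hfin.mem_zpowers_iff_mem_range_orderOf, hord] at hg
    obtain ⟨n, hn, rfl⟩ := Finset.mem_image.1 hg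
    have hn' := Finset.mem_range.1 hn
    interval_cases n
    · exact Subtype.ext (pow_zero α)
    · have := sq_smul (x : M)
      simp only [pow_one] at hgx'
      rw [hgx', hgx'] at this
      exact absurd (eq_zero_of_neg_eq this.symm) hx
    · simp only [hα, neg_smul'] at hgx'
      exact absurd (eq_zero_of_neg_eq hgx') hx
    · simp only [pow_succ α 2, hα, mul_smul, neg_smul'] at hgx'
      have hx' : α • (x : M) = -x := neg_eq_iff_eq_neg.1 hgx'
      have := sq_smul (x : M)
      rw [hx', smul_neg, hx', neg_neg] at this
      exact absurd (eq_zero_of_neg_eq this.symm) hx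
  have hcard := Nat.card_congr (MulAction.selfEquivOrbitsQuotientProd hfree)
  rw [Nat.card_prod, Nat.card_zpowers, hord] at hcard
  have hS : Nat.card S + 1 = Nat.card M := by
    have := Set.ncard_add_ncard_compl ({0} : Set M)
    rw [Set.ncard_singleton, ← Nat.card_coe_set_eq] at this
    rw [← this, add_comm]
    rfl
  rw [← hS, hcard]
  simp [Nat.ModEq, Nat.add_mod]

/-- The `p`-primary component of the nilradical, as an ideal. -/
def nilradicalPrimaryComponent (A : Type*) [CommRing A] (p : ℕ) : Ideal A where
  carrier := {x | x ∈ nilradical A ∧ ∃ k : ℕ, p ^ k • x = 0}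
  zero_mem' := ⟨zero_mem _, 0, smul_zero _⟩
  add_mem' := by
    rintro x y ⟨hx, k, hk⟩ ⟨hy, l, hl⟩
    refine ⟨add_mem hx hy, k + l, ?_⟩
    rw [smul_add, pow_add, mul_smul, mul_smul, hl, smul_comm, hk, smul_zero, smul_zero, add_zero]
  smul_mem' := by
    rintro c x ⟨hx, k, hk⟩
    exact ⟨Ideal.mul_mem_left _ c hx, k, by rw [smul_comm, hk, smul_zero]⟩

theorem finite_nilradical_of_finite_units (A : Type*) [CommRing A] [Finite Aˣ] :
    Finite (nilradical A) := by
  refine Finite.of_injective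
    (fun x : nilradical A ↦ (IsNilpotent.isUnit_one_add (mem_nilradical.1 x.2)).unit) ?_
  intro x y h
  exact Subtype.ext (add_left_cancel (congrArg Units.val h))

/-- Let `A` be a commutative ring of characteristic 0 with finite unit group such that
`-1` is a square in `Aˣ`, and let `p ≡ 3 (mod 4)` be a prime. Then the cardinality of
the `p`-primary component `N_p` of the nilradical `N` of `A` is `p ^ (2m)` for some
natural number `m`. -/
theorem stmt_19 (A : Type*) [CommRing A] [CharZero A] [Finite Aˣ]
    (hsq : ∃ α : Aˣ, α ^ 2 = -1) (p : ℕ) (hp : p.Prime) (hp3 : p % 4 = 3) :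
    ∃ m : ℕ,
      Nat.card {x : A // x ∈ nilradical A ∧ ∃ k : ℕ, p ^ k • x = 0} = p ^ (2 * m) := by
  obtain ⟨α, hα⟩ := hsq
  have := Fact.mk hp
  have := finite_nilradical_of_finite_units A
  have : Finite (nilradicalPrimaryComponent A p) :=
    Finite.of_injective (Submodule.inclusion (fun _ hx ↦ hx.1 :
      nilradicalPrimaryComponent A p ≤ nilradical A)) (Submodule.inclusion_injective _)
  have hpgroup : IsPGroup p (Multiplicative (nilradicalPrimaryComponent A p)) := by
    intro x
    obtain ⟨k, hk⟩ := x.toAdd.2.2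
    exact ⟨k, Subtype.ext hk⟩
  obtain ⟨n, hn⟩ := hpgroup.exists_card_eq
  replace hn : Nat.card (nilradicalPrimaryComponent A p) = p ^ n := hn
  have hneg : ¬α ^ 2 ^ 1 = 1 := by
    rw [pow_one, hα, Units.ext_iff]
    intro h
    have h2 : ((2 : ℕ) : A) = 0 := by
      push_cast
      rw [← one_add_one_eq_two]
      nth_rewrite 1 [← Units.val_one (α := A), ← h]
      simp
    exact two_ne_zero (Nat.cast_eq_zero.1 h2)
  have hord : orderOf α = 4 :=
    orderOf_eq_prime_pow hneg (by rw [pow_succ, pow_mul, pow_one, hα, neg_one_sq])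
  have hodd : Odd (p ^ n) := (Nat.odd_iff.2 (by omega)).pow
  have hmod := Module.card_modEq_one_of_sq_eq_neg_one (M := nilradicalPrimaryComponent A p)
    hα hord (hn ▸ hodd)
  rw [hn] at hmod
  obtain ⟨m, rfl | rfl⟩ := Nat.even_or_odd' n
  · exact ⟨m, hn⟩
  · have h9 : p ^ 2 ≡ 1 [MOD 4] := by simp [Nat.ModEq, Nat.pow_mod, hp3]
    rw [pow_succ, pow_mul] at hmod
    have hp1 : 1 ^ m * p ≡ 1 [MOD 4] := ((h9.pow m).mul_right p).symm.trans hmod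
    simp [Nat.ModEq, hp3] at hp1
end
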